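/- There exists a constant C > 0 such that for all 0 ≤ α < 1 the following holds: with high probability over the choice of the random 2-CNF Φ = Φ_{n,m} with m ~ αn clauses, the conditional expectation (over the random choices of WalkSAT only) of the total number T(Φ) of flips that WalkSAT performs on Φ satisfies E[T(Φ) | Φ] ≤ C n / (1-α)². -/

import Mathlib

open Filter

open scoped Classical

/-- A literal is a sign (`true` = positive) together with a variable. -/
abbrev Lit (V : Type) := Bool × V

/-- A 2-clause is a disjunction of two literals. -/
abbrev Clause (V : Type) := Lit V × Lit V

/-- A 2-CNF is a finite list of 2-clauses. -/
abbrev CNF (V : Type) := List (Clause V)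

/-- The negation of a literal. -/
def Lit.negate {V : Type} (l : Lit V) : Lit V := (!l.1, l.2)

/-- A literal is satisfied by an assignment if the variable is assigned its sign. -/
def litSat {V : Type} (σ : V → Bool) (l : Lit V) : Prop := σ l.2 = l.1

/-- A clause is satisfied if one of its two literals is. -/
def clauseSat {V : Type} (σ : V → Bool) (c : Clause V) : Prop := litSat σ c.1 ∨ litSat σ c.2

/-- A 2-CNF is satisfied if all of its clauses are. -/
def cnfSat {V : Type} (σ : V → Bool) (Φ : CNF V) : Prop := ∀ c ∈ Φ, clauseSat σ c

instance {V : Type} (σ : V → Bool) (l : Lit V) : Decidable (litSat σ l) := by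
  unfold litSat; infer_instance

instance {V : Type} (σ : V → Bool) (c : Clause V) : Decidable (clauseSat σ c) := by
  unfold clauseSat; infer_instance

instance {V : Type} (σ : V → Bool) (Φ : CNF V) : Decidable (cnfSat σ Φ) := by
  unfold cnfSat; infer_instance

/-- In a proper 2-CNF, the two literals of each clause have distinct variables. -/
def validCNF {V : Type} (Φ : CNF V) : Prop := ∀ c ∈ Φ, c.1.2 ≠ c.2.2

/-- A set `L` of literals is closed under Unit Clause Propagation on `Φ`:
whenever a clause can be written `¬ l' ∨ l''` with `l' ∈ L`, also `l'' ∈ L`. -/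
def ucpClosed {V : Type} (Φ : CNF V) (L : Set (Lit V)) : Prop :=
  ∀ c ∈ Φ, (Lit.negate c.1 ∈ L → c.2 ∈ L) ∧ (Lit.negate c.2 ∈ L → c.1 ∈ L)

/-- `ℒ(Φ, {l})`: the set of literals produced by UCP from `{l}`, i.e. the least
set containing `l` that is closed under unit clause propagation. -/
def ucpLits {V : Type} (Φ : CNF V) (l : Lit V) : Set (Lit V) :=
  ⋂₀ {L : Set (Lit V) | l ∈ L ∧ ucpClosed Φ L}

/-- `𝒱(Φ, {l})`: the variables underlying `ℒ(Φ, {l})`. -/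
def ucpVars {V : Type} (Φ : CNF V) (l : Lit V) : Set V := Prod.snd '' ucpLits Φ l

/-! ### WalkSAT -/

/-- Flip the value of variable `v` in assignment `σ`. -/
def flipVar {V : Type} [DecidableEq V] (σ : V → Bool) (v : V) : V → Bool :=
  fun u => if u = v then !σ u else σ u

/-- The list of clauses of `Φ` violated by `σ`. -/
def violated {V : Type} (Φ : CNF V) (σ : V → Bool) : List (Clause V) :=
  Φ.filter fun c => decide (¬ clauseSat σ c)

/-- One step of WalkSAT, driven by a random seed `s`.  If `σ` violates some clause,
then a violated clause is selected via `s.1 % (number of violated clauses)`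
(this is a uniformly random violated clause, since `s.1` is uniform on
`Fin (Φ.length)!` and the number of violated clauses divides `(Φ.length)!`),
one of its two literals is selected via the uniform bit `s.2`, and the underlying
variable is flipped.  If `σ` satisfies `Φ`, nothing happens. -/
def wsNext {V : Type} [DecidableEq V] (Φ : CNF V) (s : ℕ × Bool) (σ : V → Bool) : V → Bool :=
  if h : (violated Φ σ).length = 0 then σ
  else
    let c := (violated Φ σ).get ⟨s.1 % (violated Φ σ).length, Nat.mod_lt _ (Nat.pos_of_ne_zero h)⟩
    flipVar σ (if s.2 then c.1.2 else c.2.2)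

/-- The space of random seeds driving one run of WalkSAT on `Φ` (at most
`100 n²` steps, each using an independent uniform pair).  The uniform measure on
this finite space makes each step's clause/literal choices uniform and independent. -/
abbrev wsSeedSpace (V : Type) [Fintype V] (Φ : CNF V) : Type :=
  Fin (100 * (Fintype.card V) ^ 2) → Fin (Nat.factorial Φ.length) × Bool

/-- `σ^{(t)}`: the WalkSAT assignment after `t` steps, starting from the all-true
assignment, for the realization `ω` of the random seeds.  After `100 n²` steps, or
once `Φ` is satisfied, the assignment no longer changes. -/
def wsState {V : Type} [Fintype V] [DecidableEq V] (Φ : CNF V) (ω : wsSeedSpace V Φ) :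
    ℕ → (V → Bool)
  | 0 => fun _ => true
  | t + 1 =>
    if h : t < 100 * (Fintype.card V) ^ 2 then
      wsNext Φ (((ω ⟨t, h⟩).1 : ℕ), (ω ⟨t, h⟩).2) (wsState Φ ω t)
    else wsState Φ ω t

/-- `T(Φ)`: the total number of flips WalkSAT performs, i.e. the first time the
current assignment satisfies `Φ` (capped at the time limit `100 n²`). -/
noncomputable def wsT {V : Type} [Fintype V] [DecidableEq V] (Φ : CNF V)
    (ω : wsSeedSpace V Φ) : ℕ :=
  sInf ({t | cnfSat (wsState Φ ω t) Φ} ∪ {100 * (Fintype.card V) ^ 2})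

/-- `N(Φ, l)`: the total number of times WalkSAT flips variables from `𝒱(Φ,{l})`. -/
noncomputable def wsN {V : Type} [Fintype V] [DecidableEq V] (Φ : CNF V)
    (ω : wsSeedSpace V Φ) (l : Lit V) : ℕ :=
  ∑ v ∈ (Set.toFinite (ucpVars Φ l)).toFinset,
    ∑ t ∈ Finset.Icc 1 (wsT Φ ω),
      if wsState Φ ω (t - 1) v ≠ wsState Φ ω t v then 1 else 0

/-- Expectation over the random choices of WalkSAT (uniform over all seeds). -/
noncomputable def wsExp {V : Type} [Fintype V] [DecidableEq V] (Φ : CNF V)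
    (g : wsSeedSpace V Φ → ℝ) : ℝ :=
  (∑ ω : wsSeedSpace V Φ, g ω) / (Fintype.card (wsSeedSpace V Φ) : ℝ)

/-! ### The random formula `Φ_{n,m}` -/

/-- A sample point for the random 2-CNF: an ordered tuple of `m` clauses on the
variables `x₁, …, xₙ`. -/
abbrev FSpace (n m : ℕ) : Type := Fin m → Clause (Fin n)

/-- The 2-CNF corresponding to a sample point. -/
def toCNF {n m : ℕ} (f : FSpace n m) : CNF (Fin n) := List.ofFn f

/-- The set of proper sample points: each of the `m` clauses is one of the
`4n(n-1)` 2-clauses on two distinct variables.  The uniform distribution on this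
finite set is exactly the distribution of `Φ_{n,m}` (m independent uniform clauses). -/
noncomputable def validFormulas (n m : ℕ) : Finset (FSpace n m) :=
  Finset.univ.filter fun f => ∀ i, (f i).1.2 ≠ (f i).2.2

/-- Probability of an event under the random 2-CNF `Φ_{n,m}`. -/
noncomputable def prF (n m : ℕ) (P : FSpace n m → Prop) : ℝ :=
  (((validFormulas n m).filter fun f => P f).card : ℝ) / ((validFormulas n m).card : ℝ)

/-- Expectation of a functional of the random 2-CNF `Φ_{n,m}`. -/
noncomputable def expF (n m : ℕ) (g : FSpace n m → ℝ) : ℝ :=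
  (∑ f ∈ validFormulas n m, g f) / ((validFormulas n m).card : ℝ)

/-- `X(Φ) = Σ_x (|𝒱(Φ,{x})|² + |𝒱(Φ,{¬x})|²)`. -/
noncomputable def Xval (n : ℕ) (Φ : CNF (Fin n)) : ℝ :=
  ∑ x : Fin n,
    (((ucpVars Φ (true, x)).ncard : ℝ) ^ 2 + ((ucpVars Φ (false, x)).ncard : ℝ) ^ 2)

section WalkSATBound

variable {V : Type}

/-- Flip the coin used by the `t`-th step. -/
def flipCoin {N : ℕ} {A : Type} (t : Fin N) (ω : Fin N → A × Bool) : Fin N → A × Bool :=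
  Function.update ω t ((ω t).1, !(ω t).2)

lemma flipCoin_involutive {N : ℕ} {A : Type} (t : Fin N) :
    Function.Involutive (flipCoin (A := A) t) := by
  intro ω
  simp [flipCoin]

lemma wsState_flipCoin [Fintype V] [DecidableEq V] (Φ : CNF V) (ω : wsSeedSpace V Φ)
    (t : Fin (100 * (Fintype.card V) ^ 2)) (s : ℕ) (hs : s ≤ t) :
    wsState Φ (flipCoin t ω) s = wsState Φ ω s := by
  induction s with
  | zero => rfl
  | succ s ih =>
    have hlt : s < 100 * (Fintype.card V) ^ 2 := by have := t.2; omega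
    have hne : (⟨s, hlt⟩ : Fin (100 * (Fintype.card V) ^ 2)) ≠ t := by
      intro h; rw [← h] at hs; simp at hs
    simp only [wsState, hlt, dif_pos]
    rw [ih (by omega)]
    simp [flipCoin, Function.update_of_ne hne]

lemma cnfSat_iff_violated (Φ : CNF V) (σ : V → Bool) :
    cnfSat σ Φ ↔ (violated Φ σ).length = 0 := by
  simp [violated, cnfSat]

lemma wsT_le_card [Fintype V] [DecidableEq V] (Φ : CNF V) (ω : wsSeedSpace V Φ) :
    wsT Φ ω ≤ ((Finset.range (100 * (Fintype.card V) ^ 2)).filter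
      fun s => ¬ cnfSat (wsState Φ ω s) Φ).card := by
  have hT : wsT Φ ω ≤ 100 * (Fintype.card V) ^ 2 := Nat.sInf_le (by simp)
  calc wsT Φ ω = (Finset.range (wsT Φ ω)).card := by simp
    _ ≤ _ := by
      apply Finset.card_le_card
      intro s hs
      have hs' : s < wsT Φ ω := Finset.mem_range.1 hs
      have hn := Nat.notMem_of_lt_sInf hs'
      simp only [Finset.mem_filter, Finset.mem_range]
      refine ⟨by omega, fun h => hn (Or.inl h)⟩

lemma wsNext_pair_le [DecidableEq V] (Φ : CNF V) (Ψ : (V → Bool) → ℝ)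
    (hstep : ∀ σ, ∀ c ∈ Φ, ¬ clauseSat σ c →
      Ψ (flipVar σ c.1.2) + Ψ (flipVar σ c.2.2) + 2 ≤ 2 * Ψ σ)
    (σ : V → Bool) (a : ℕ) (b : Bool) :
    Ψ (wsNext Φ (a, b) σ) + Ψ (wsNext Φ (a, !b) σ) + 2 * (if cnfSat σ Φ then 0 else 1) ≤
      2 * Ψ σ := by
  by_cases h : (violated Φ σ).length = 0
  · have hs : cnfSat σ Φ := (cnfSat_iff_violated Φ σ).2 h
    simp only [wsNext, h, dif_pos, hs, if_true]
    linarith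
  · have hs : ¬ cnfSat σ Φ := fun h' => h ((cnfSat_iff_violated Φ σ).1 h')
    have hlt := Nat.mod_lt a (Nat.pos_of_ne_zero h)
    have hmem : (violated Φ σ).get ⟨a % (violated Φ σ).length, hlt⟩ ∈ violated Φ σ :=
      List.get_mem _ _
    simp only [violated, List.mem_filter, decide_eq_true_eq] at hmem
    have := hstep σ _ hmem.1 hmem.2
    simp only [wsNext, h, hs, dif_neg, not_false_eq_true, if_false]
    cases b <;> simp only [Bool.not_false, Bool.not_true, if_true, Bool.false_eq_true, if_false] <;>
      simp only [violated] at this ⊢ <;> linarith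

/-- A nonnegative potential that drops by at least one in expectation at every flip
bounds the expected number of flips of WalkSAT. -/
theorem wsExp_wsT_le [Fintype V] [DecidableEq V] (Φ : CNF V) (Ψ : (V → Bool) → ℝ) (h0 : ∀ σ, 0 ≤ Ψ σ)
    (hstep : ∀ σ, ∀ c ∈ Φ, ¬ clauseSat σ c →
      Ψ (flipVar σ c.1.2) + Ψ (flipVar σ c.2.2) + 2 ≤ 2 * Ψ σ) :
    wsExp Φ (fun ω => (wsT Φ ω : ℝ)) ≤ Ψ (fun _ => true) := by
  set N := 100 * (Fintype.card V) ^ 2 with hN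
  let u : wsSeedSpace V Φ → ℕ → ℝ := fun ω s => if cnfSat (wsState Φ ω s) Φ then 0 else 1
  let g : ℕ → wsSeedSpace V Φ → ℝ := fun t ω =>
    Ψ (wsState Φ ω t) + ∑ s ∈ Finset.range t, u ω s
  have key : ∀ t, t ≤ N → ∑ ω, g t ω ≤ ∑ ω, g 0 ω := by
    intro t
    induction t with
    | zero => intro _; exact le_rfl
    | succ t ih =>
      intro ht
      refine le_trans ?_ (ih (by omega))
      have htN : t < N := ht
      let e := (flipCoin_involutive (A := Fin (Nat.factorial Φ.length))
        (⟨t, htN⟩ : Fin N)).toPerm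
      have hsum : ∀ F : wsSeedSpace V Φ → ℝ,
          ∑ ω, F ω = ∑ ω, F (flipCoin (⟨t, htN⟩ : Fin N) ω) := fun F =>
        (Equiv.sum_comp e F).symm
      have h2 : 2 * ∑ ω, g (t + 1) ω
          = ∑ ω, (g (t + 1) ω + g (t + 1) (flipCoin (⟨t, htN⟩ : Fin N) ω)) := by
        have h := hsum (g (t + 1))
        have h' := Finset.sum_add_distrib (s := Finset.univ) (f := g (t + 1))
          (g := fun ω => g (t + 1) (flipCoin (⟨t, htN⟩ : Fin N) ω))
        linarith
      have h3 : ∑ ω, (g (t + 1) ω + g (t + 1) (flipCoin (⟨t, htN⟩ : Fin N) ω)) ≤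
          ∑ ω, 2 * g t ω := by
        apply Finset.sum_le_sum
        intro ω _
        have hu : ∀ s ∈ Finset.range (t + 1), u (flipCoin (⟨t, htN⟩ : Fin N) ω) s = u ω s := by
          intro s hs
          have : s ≤ t := by simpa [Nat.lt_succ_iff] using hs
          simp only [u]
          rw [wsState_flipCoin Φ ω (⟨t, htN⟩ : Fin N) s this]
        have hst := wsState_flipCoin Φ ω (⟨t, htN⟩ : Fin N) t le_rfl
        have hp := wsNext_pair_le Φ Ψ hstep (wsState Φ ω t) (ω ⟨t, htN⟩).1 (ω ⟨t, htN⟩).2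
        have e1 : wsState Φ ω (t + 1) =
            wsNext Φ (((ω ⟨t, htN⟩).1 : ℕ), (ω ⟨t, htN⟩).2) (wsState Φ ω t) := by
          simp only [wsState]; exact dif_pos htN
        have e2 : wsState Φ (flipCoin (⟨t, htN⟩ : Fin N) ω) (t + 1) =
            wsNext Φ (((ω ⟨t, htN⟩).1 : ℕ), !(ω ⟨t, htN⟩).2) (wsState Φ ω t) := by
          simp only [wsState]
          refine (dif_pos htN).trans ?_
          rw [hst]; simp [flipCoin]
        simp only [g]
        rw [Finset.sum_congr rfl hu, Finset.sum_range_succ, e1, e2]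
        simp only [u]
        linarith
      rw [← Finset.mul_sum] at h3
      linarith
  have hcard : (0 : ℝ) < (Fintype.card (wsSeedSpace V Φ) : ℝ) := by
    have : 0 < Fintype.card (wsSeedSpace V Φ) := by
      have : Nonempty (Fin (Nat.factorial Φ.length)) := ⟨⟨0, Nat.factorial_pos _⟩⟩
      exact Fintype.card_pos
    exact_mod_cast this
  unfold wsExp
  rw [div_le_iff₀ hcard]
  calc ∑ ω, (wsT Φ ω : ℝ) ≤ ∑ ω, g N ω := by
        apply Finset.sum_le_sum
        intro ω _
        have h1 : (wsT Φ ω : ℝ) ≤ ∑ s ∈ Finset.range N, u ω s := by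
          have := wsT_le_card Φ ω
          have h2 : ∑ s ∈ Finset.range N, u ω s = (((Finset.range N).filter
              fun s => ¬ cnfSat (wsState Φ ω s) Φ).card : ℝ) := by
            rw [Finset.card_filter]; push_cast
            apply Finset.sum_congr rfl
            intro s _
            simp only [u]; split_ifs <;> simp_all
          rw [h2]; exact_mod_cast this
        have := h0 (wsState Φ ω N)
        simp only [g]; linarith
    _ ≤ ∑ ω, g 0 ω := key N le_rfl
    _ = _ := by simp [g, wsState, mul_comm]

/-- The variables of `U` on which `σ` and `τ` differ. -/
def diffOn (U : Finset V) (τ σ : V → Bool) : Finset V := U.filter fun v => σ v ≠ τ v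

/-- The quadratic potential of a finite set of variables relative to a target assignment. -/
def setPotential (U : Finset V) (τ σ : V → Bool) : ℝ :=
  2 * (U.card : ℝ) * ((diffOn U τ σ).card : ℝ) - ((diffOn U τ σ).card : ℝ) ^ 2

lemma card_diffOn_le (U : Finset V) (τ σ : V → Bool) :
    ((diffOn U τ σ).card : ℝ) ≤ U.card := by
  exact_mod_cast Finset.card_filter_le _ _

lemma setPotential_nonneg (U : Finset V) (τ σ : V → Bool) : 0 ≤ setPotential U τ σ := by
  have h1 := card_diffOn_le U τ σ
  have h2 : (0 : ℝ) ≤ (diffOn U τ σ).card := by positivity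
  unfold setPotential; nlinarith

lemma setPotential_le (U : Finset V) (τ σ : V → Bool) :
    setPotential U τ σ ≤ (U.card : ℝ) ^ 2 := by
  unfold setPotential
  nlinarith [sq_nonneg ((U.card : ℝ) - ((diffOn U τ σ).card : ℝ))]

lemma diffOn_flip_of_notMem [DecidableEq V] {U : Finset V} {τ σ : V → Bool} {v : V} (hv : v ∉ U) :
    diffOn U τ (flipVar σ v) = diffOn U τ σ := by
  apply Finset.filter_congr
  intro u hu
  have : u ≠ v := fun h => hv (h ▸ hu)
  simp [flipVar, this]

lemma card_diffOn_flip_of_ne [DecidableEq V] {U : Finset V} {τ σ : V → Bool} {v : V} (hv : v ∈ U)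
    (h : σ v ≠ τ v) :
    ((diffOn U τ (flipVar σ v)).card : ℝ) = (diffOn U τ σ).card - 1 := by
  have hm : v ∈ diffOn U τ σ := by simp [diffOn, hv, h]
  have he : diffOn U τ (flipVar σ v) = (diffOn U τ σ).erase v := by
    ext u
    by_cases hu : u = v
    · subst hu
      cases h1 : σ u <;> cases h2 : τ u <;> simp_all [diffOn, flipVar]
    · simp only [diffOn, Finset.mem_filter, Finset.mem_erase]
      simp [flipVar, hu]
  rw [he, Finset.card_erase_of_mem hm, Nat.cast_sub (Finset.card_pos.2 ⟨v, hm⟩)]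
  simp

lemma card_diffOn_flip_of_eq [DecidableEq V] {U : Finset V} {τ σ : V → Bool} {v : V} (hv : v ∈ U)
    (h : σ v = τ v) :
    ((diffOn U τ (flipVar σ v)).card : ℝ) = (diffOn U τ σ).card + 1 := by
  have hm : v ∉ diffOn U τ σ := by simp [diffOn, h]
  have he : diffOn U τ (flipVar σ v) = insert v (diffOn U τ σ) := by
    ext u
    by_cases hu : u = v
    · subst hu
      cases h1 : τ u <;> simp_all [diffOn, flipVar]
    · simp only [diffOn, Finset.mem_filter, Finset.mem_insert]
      simp [flipVar, hu]
  rw [he, Finset.card_insert_of_notMem hm]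
  push_cast; ring

lemma setPotential_step [DecidableEq V] {Φ : CNF V} {L : Set (Lit V)} (hL : ucpClosed Φ L) {τ σ : V → Bool}
    (hτ : cnfSat τ Φ) (hLτ : ∀ l ∈ L, τ l.2 = l.1) (U : Finset V)
    (hU : ∀ v, v ∈ U ↔ ∃ l ∈ L, l.2 = v) {c : Clause V} (hc : c ∈ Φ) (hσ : ¬ clauseSat σ c) :
    setPotential U τ (flipVar σ c.1.2) + setPotential U τ (flipVar σ c.2.2) +
      ((if c.1.2 ∈ U then 1 else 0) + (if c.2.2 ∈ U then 1 else 0)) ≤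
      2 * setPotential U τ σ := by
  have hcl := hL c hc
  have hsat := hτ c hc
  obtain ⟨⟨a, v⟩, ⟨b, w⟩⟩ := c
  simp only [clauseSat, litSat, not_or] at hσ hsat
  obtain ⟨h1, h2⟩ := hσ
  have hd := card_diffOn_le U τ σ
  have key1 : v ∈ U → w ∉ U → σ v ≠ τ v := by
    intro hv hw heq
    obtain ⟨l, hl, hlv⟩ := (hU v).1 hv
    apply hw
    rw [hU]
    refine ⟨(b, w), hcl.1 ?_, rfl⟩
    have : Lit.negate (a, v) = l := by
      have := hLτ l hl
      apply Prod.ext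
      · rw [← this, hlv, ← heq]
        cases a <;> cases h : σ v <;> simp_all [Lit.negate]
      · exact hlv.symm
    simp only [this, hl]
  have key2 : w ∈ U → v ∉ U → σ w ≠ τ w := by
    intro hv hw heq
    obtain ⟨l, hl, hlv⟩ := (hU w).1 hv
    apply hw
    rw [hU]
    refine ⟨(a, v), hcl.2 ?_, rfl⟩
    have : Lit.negate (b, w) = l := by
      have := hLτ l hl
      apply Prod.ext
      · rw [← this, hlv, ← heq]
        cases b <;> cases h : σ w <;> simp_all [Lit.negate]
      · exact hlv.symm
    simp only [this, hl]
  have key3 : σ v ≠ τ v ∨ σ w ≠ τ w := by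
    rcases hsat with h | h
    · left; rw [h]; exact h1
    · right; rw [h]; exact h2
  by_cases hv : v ∈ U <;> by_cases hw : w ∈ U <;>
    simp only [hv, hw, if_true, if_false, setPotential]
  · by_cases e1 : σ v = τ v <;> by_cases e2 : σ w = τ w
    · tauto
    · rw [card_diffOn_flip_of_eq hv e1, card_diffOn_flip_of_ne hw e2]; nlinarith
    · rw [card_diffOn_flip_of_ne hv e1, card_diffOn_flip_of_eq hw e2]; nlinarith
    · rw [card_diffOn_flip_of_ne hv e1, card_diffOn_flip_of_ne hw e2]; nlinarith
  · rw [card_diffOn_flip_of_ne hv (key1 hv hw), diffOn_flip_of_notMem hw]; nlinarith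
  · rw [card_diffOn_flip_of_ne hw (key2 hw hv), diffOn_flip_of_notMem hv]; nlinarith
  · rw [diffOn_flip_of_notMem hw, diffOn_flip_of_notMem hv]; nlinarith

/-- The expected number of flips is at most the sum, over all variables `x`, of the squared
size of any unit-propagation-closed set of literals that contains a literal of `x` and is
true under some fixed satisfying assignment. -/
theorem wsExp_wsT_le_sum_sq [Fintype V] [DecidableEq V] {Φ : CNF V} {τ : V → Bool}
    (hτ : cnfSat τ Φ) (L : V → Finset (Lit V)) (hL : ∀ x, ucpClosed Φ (L x : Set (Lit V)))
    (hLτ : ∀ x, ∀ l ∈ L x, τ l.2 = l.1) (hx : ∀ x, (τ x, x) ∈ L x) :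
    wsExp Φ (fun ω => (wsT Φ ω : ℝ)) ≤ ∑ x, ((L x).card : ℝ) ^ 2 := by
  let U : V → Finset V := fun x => (L x).image Prod.snd
  have hU : ∀ x v, v ∈ U x ↔ ∃ l ∈ (L x : Set (Lit V)), l.2 = v := by
    intro x v; simp [U]
  refine (wsExp_wsT_le Φ (fun σ => ∑ x, setPotential (U x) τ σ)
    (fun σ => Finset.sum_nonneg fun x _ => setPotential_nonneg _ _ _) ?_).trans ?_
  · intro σ c hc hσ
    have h := Finset.sum_le_sum fun x (_ : x ∈ Finset.univ) =>
      setPotential_step (hL x) hτ (hLτ x) (U x) (hU x) hc hσ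
    simp only [Finset.sum_add_distrib, ← Finset.mul_sum] at h
    have hmem : ∀ x, x ∈ U x := fun x => (hU x x).2 ⟨_, hx x, rfl⟩
    have one : ∀ y : V, (1 : ℝ) ≤ ∑ x, if y ∈ U x then 1 else 0 := by
      intro y
      have := Finset.single_le_sum (f := fun x => if y ∈ U x then (1 : ℝ) else 0)
        (fun x _ => by positivity) (Finset.mem_univ y)
      simpa [hmem] using this
    have := one c.1.2
    have := one c.2.2
    linarith
  · apply Finset.sum_le_sum
    intro x _
    refine (setPotential_le _ _ _).trans ?_
    have : (U x).card ≤ (L x).card := Finset.card_image_le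
    gcongr

end WalkSATBound

section Trails

variable {V ι : Type}

@[simp] lemma Lit.negate_negate (l : Lit V) : l.negate.negate = l := by
  simp [Lit.negate]

@[simp] lemma Lit.negate_snd (l : Lit V) : l.negate.2 = l.2 := rfl

lemma Lit.negate_ne (l : Lit V) : l.negate ≠ l := by
  intro h
  have := congrArg Prod.fst h
  simp [Lit.negate] at this

lemma Lit.negate_eq_iff {l k : Lit V} : l.negate = k ↔ l = k.negate := by
  constructor <;> (intro h; subst h; simp)

/-- The clause `c` yields the implication `l → l'`. -/
def clauseEdge (c : Clause V) (l l' : Lit V) : Prop :=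
  (c.1 = l.negate ∧ c.2 = l') ∨ (c.2 = l.negate ∧ c.1 = l')

lemma clauseEdge.contra {c : Clause V} {l l' : Lit V} (h : clauseEdge c l l') :
    clauseEdge c l'.negate l.negate := by
  rcases h with ⟨h1, h2⟩ | ⟨h1, h2⟩
  · right; simp [h1, h2]
  · left; simp [h1, h2]

lemma clauseEdge.unique {c : Clause V} {p q y z : Lit V} (h : clauseEdge c p q)
    (h' : clauseEdge c y z) : (p = y ∧ q = z) ∨ (p = z.negate ∧ q = y.negate) := by
  rcases h with ⟨h1, h2⟩ | ⟨h1, h2⟩ <;> rcases h' with ⟨h3, h4⟩ | ⟨h3, h4⟩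
  · left; exact ⟨by rw [← Lit.negate_negate p, ← h1, h3, Lit.negate_negate], by rw [← h2, h4]⟩
  · right; exact ⟨by rw [← h4, h1, Lit.negate_negate], by rw [← h2, h3]⟩
  · right; exact ⟨by rw [← h4, h1, Lit.negate_negate], by rw [← h2, h3]⟩
  · left; exact ⟨by rw [← Lit.negate_negate p, ← h1, h3, Lit.negate_negate], by rw [← h2, h4]⟩

/-- `w` lists the steps (clause index, new literal) of a walk from `l` in the implication
digraph of the clauses `f`. -/
def IsWalk (f : ι → Clause V) : Lit V → List (ι × Lit V) → Prop
  | _, [] => True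
  | l, s :: w => clauseEdge (f s.1) l s.2 ∧ IsWalk f s.2 w

/-- The literal at which a walk from `l` with steps `w` ends. -/
def walkEnd : Lit V → List (ι × Lit V) → Lit V
  | l, [] => l
  | _, s :: w => walkEnd s.2 w

/-- The clause indices used by a walk. -/
abbrev walkIdx (w : List (ι × Lit V)) : List ι := w.map Prod.fst

/-- The variables reached by the steps of a walk. -/
abbrev walkVars (w : List (ι × Lit V)) : List V := w.map fun s => s.2.2

lemma walkEnd_append (l : Lit V) (w w' : List (ι × Lit V)) :
    walkEnd l (w ++ w') = walkEnd (walkEnd l w) w' := by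
  induction w generalizing l with
  | nil => rfl
  | cons s w ih => exact ih s.2

lemma isWalk_append {f : ι → Clause V} {l : Lit V} {w w' : List (ι × Lit V)} :
    IsWalk f l (w ++ w') ↔ IsWalk f l w ∧ IsWalk f (walkEnd l w) w' := by
  induction w generalizing l with
  | nil => simp [IsWalk, walkEnd]
  | cons s w ih => simp [IsWalk, walkEnd, ih, and_assoc]

lemma walkEnd_mem (l : Lit V) (w : List (ι × Lit V)) :
    (walkEnd l w).2 = l.2 ∨ (walkEnd l w).2 ∈ walkVars w := by
  induction w generalizing l with
  | nil => left; rfl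
  | cons s w ih =>
    right
    rcases ih s.2 with h | h
    · simp [walkEnd, h]
    · simp only [walkVars, List.map_cons, List.mem_cons, walkEnd]; exact Or.inr h

lemma exists_reverse_walk {f : ι → Clause V} {l : Lit V} {w : List (ι × Lit V)}
    (h : IsWalk f l w) : ∃ w', IsWalk f (walkEnd l w).negate w' ∧
      walkEnd (walkEnd l w).negate w' = l.negate ∧ walkIdx w' = (walkIdx w).reverse := by
  induction w generalizing l with
  | nil => exact ⟨[], trivial, rfl, rfl⟩
  | cons s w ih =>
    obtain ⟨w', h1, h2, h3⟩ := ih h.2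
    refine ⟨w' ++ [(s.1, l.negate)], ?_, ?_, ?_⟩
    · rw [isWalk_append]
      refine ⟨h1, ?_⟩
      simp only [walkEnd, h2, IsWalk, and_true]
      exact h.1.contra
    · rw [walkEnd_append]; rfl
    · simp only [walkIdx] at h3 ⊢; simp [h3]

/-- `y` is reached from `l` by a walk that uses each clause with index in `I` at most once,
and no other clause. -/
def TrailReach (f : ι → Clause V) (I : Finset ι) (l y : Lit V) : Prop :=
  ∃ w, IsWalk f l w ∧ (walkIdx w).Nodup ∧ (∀ i ∈ walkIdx w, i ∈ I) ∧ walkEnd l w = y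

lemma TrailReach.refl (f : ι → Clause V) (I : Finset ι) (l : Lit V) : TrailReach f I l l :=
  ⟨[], trivial, List.nodup_nil, by simp, rfl⟩

lemma TrailReach.mono {f : ι → Clause V} {I J : Finset ι} (hIJ : I ⊆ J) {l y : Lit V}
    (h : TrailReach f I l y) : TrailReach f J l y := by
  obtain ⟨w, h1, h2, h3, h4⟩ := h
  exact ⟨w, h1, h2, fun i hi => hIJ (h3 i hi), h4⟩

lemma TrailReach.contra {f : ι → Clause V} {I : Finset ι} {l y : Lit V}
    (h : TrailReach f I l y) : TrailReach f I y.negate l.negate := by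
  obtain ⟨w, h1, h2, h3, rfl⟩ := h
  obtain ⟨w', h4, h5, h6⟩ := exists_reverse_walk h1
  exact ⟨w', h4, by rw [h6]; exact List.nodup_reverse.2 h2, by rw [h6]; simpa using h3, h5⟩

lemma IsWalk.congr {f g : ι → Clause V} {l : Lit V} {w : List (ι × Lit V)}
    (h : IsWalk f l w) (hfg : ∀ i ∈ walkIdx w, f i = g i) : IsWalk g l w := by
  induction w generalizing l with
  | nil => trivial
  | cons s w ih =>
    rw [walkIdx, List.map_cons, List.forall_mem_cons] at hfg
    exact ⟨hfg.1 ▸ h.1, ih h.2 hfg.2⟩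

lemma TrailReach.congr {f g : ι → Clause V} {I : Finset ι} (hfg : ∀ i ∈ I, f i = g i)
    {l y : Lit V} (h : TrailReach f I l y) : TrailReach g I l y := by
  obtain ⟨w, h1, h2, h3, h4⟩ := h
  exact ⟨w, h1.congr fun i hi => hfg i (h3 i hi), h2, h3, h4⟩

lemma ne_nil_of_walkEnd_negate {l : Lit V} {w : List (ι × Lit V)}
    (h : walkEnd l w = l.negate) : w ≠ [] := by
  rintro rfl
  exact Lit.negate_ne l h.symm

variable [DecidableEq ι]

lemma TrailReach.first_step {f : ι → Clause V} {I : Finset ι} {l y : Lit V}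
    (h : TrailReach f I l y) :
    y = l ∨ ∃ i ∈ I, ∃ l', clauseEdge (f i) l l' ∧ TrailReach f (I.erase i) l' y := by
  obtain ⟨w, h1, h2, h3, rfl⟩ := h
  cases w with
  | nil => left; rfl
  | cons s w =>
    right
    simp only [walkIdx, List.map_cons, List.nodup_cons, List.mem_cons, forall_eq_or_imp] at h2 h3
    refine ⟨s.1, h3.1, s.2, h1.1, w, h1.2, h2.2, fun i hi => ?_, rfl⟩
    exact Finset.mem_erase.2 ⟨fun h => h2.1 (h ▸ hi), h3.2 i hi⟩

lemma TrailReach.delete {f : ι → Clause V} {I : Finset ι} {l y : Lit V}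
    (h : TrailReach f I l y) (i : ι) :
    TrailReach f (I.erase i) l y ∨
      ∃ p q, clauseEdge (f i) p q ∧ TrailReach f (I.erase i) l p ∧
        TrailReach f (I.erase i) q y := by
  obtain ⟨w, h1, h2, h3, rfl⟩ := h
  by_cases hi : i ∈ walkIdx w
  · right
    obtain ⟨⟨i', q⟩, hs, rfl⟩ := List.mem_map.1 hi
    obtain ⟨a, b, rfl⟩ := List.append_of_mem hs
    rw [isWalk_append] at h1
    simp only [walkIdx, List.map_append, List.map_cons, List.nodup_append, List.nodup_cons] at h2
    simp only [walkIdx, List.map_append, List.map_cons, List.mem_append, List.mem_cons] at h3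
    refine ⟨walkEnd l a, q, h1.2.1, ⟨a, h1.1, h2.1, ?_, rfl⟩, ⟨b, h1.2.2, h2.2.1.2, ?_, ?_⟩⟩
    · intro j hj
      exact Finset.mem_erase.2 ⟨h2.2.2 j hj _ (List.mem_cons_self ..), h3 j (Or.inl hj)⟩
    · intro j hj
      exact Finset.mem_erase.2 ⟨by rintro rfl; exact h2.2.1.1 hj, h3 j (Or.inr (Or.inr hj))⟩
    · rw [walkEnd_append]; rfl
  · left
    exact ⟨w, h1, h2, fun j hj => Finset.mem_erase.2 ⟨fun e => hi (e ▸ hj), h3 j hj⟩, rfl⟩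

lemma TrailReach.delete_edge {f : ι → Clause V} {I : Finset ι} {l y u u' : Lit V} {i : ι}
    (hu : clauseEdge (f i) u u') (h : TrailReach f I l y) :
    TrailReach f (I.erase i) l y ∨
      (TrailReach f (I.erase i) l u ∧ TrailReach f (I.erase i) u' y) ∨
      (TrailReach f (I.erase i) l u'.negate ∧ TrailReach f (I.erase i) u.negate y) := by
  rcases h.delete i with h | ⟨p, q, hpq, h1, h2⟩
  · exact Or.inl h
  · rcases hpq.unique hu with ⟨rfl, rfl⟩ | ⟨rfl, rfl⟩
    · exact Or.inr (Or.inl ⟨h1, h2⟩)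
    · exact Or.inr (Or.inr ⟨h1, h2⟩)

variable [DecidableEq V]

/-- There is a walk from `l`, using each clause with index in `I` at most once, at least `c`
of whose steps lead to a variable in `A` or to a variable visited before. -/
inductive Closings (f : ι → Clause V) : ℕ → Finset ι → Finset V → Lit V → Prop
  | zero (I : Finset ι) (A : Finset V) (l : Lit V) : Closings f 0 I A l
  | hit {c : ℕ} {I : Finset ι} {A : Finset V} {l l' : Lit V} {i : ι} (hi : i ∈ I)
      (he : clauseEdge (f i) l l') (hA : l'.2 ∈ A) (h : Closings f c (I.erase i) A l') :
      Closings f (c + 1) I A l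
  | move {c : ℕ} {I : Finset ι} {A : Finset V} {l l' : Lit V} {i : ι} (hi : i ∈ I)
      (he : clauseEdge (f i) l l') (h : Closings f c (I.erase i) (insert l'.2 A) l') :
      Closings f c I A l

lemma Closings.first_step {f : ι → Clause V} {c : ℕ} {I : Finset ι} {A : Finset V} {l : Lit V}
    (h : Closings f (c + 1) I A l) : ∃ i ∈ I, ∃ l', clauseEdge (f i) l l' ∧
      ((l'.2 ∈ A ∧ Closings f c (I.erase i) A l') ∨
        Closings f (c + 1) (I.erase i) (insert l'.2 A) l') := by
  cases h with
  | hit hi he hA h => exact ⟨_, hi, _, he, Or.inl ⟨hA, h⟩⟩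
  | move hi he h => exact ⟨_, hi, _, he, Or.inr h⟩

lemma Closings.congr {f g : ι → Clause V} {c : ℕ} {I : Finset ι} {A : Finset V} {l : Lit V}
    (h : Closings f c I A l) (hfg : ∀ i ∈ I, f i = g i) : Closings g c I A l := by
  induction h with
  | zero I A l => exact .zero I A l
  | hit hi he hA _ ih =>
    exact .hit hi (hfg _ hi ▸ he) hA (ih fun i hi' => hfg i (Finset.mem_of_mem_erase hi'))
  | move hi he _ ih =>
    exact .move hi (hfg _ hi ▸ he) (ih fun i hi' => hfg i (Finset.mem_of_mem_erase hi'))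

lemma Closings.mono {f : ι → Clause V} {c : ℕ} {I J : Finset ι} {A B : Finset V} {l : Lit V}
    (h : Closings f c I A l) (hI : I ⊆ J) (hA : A ⊆ B) : Closings f c J B l := by
  induction h generalizing J B with
  | zero I A l => exact .zero J B l
  | hit hi he hl _ ih =>
    exact .hit (hI hi) he (hA hl) (ih (Finset.erase_subset_erase _ hI) hA)
  | move hi he _ ih =>
    exact .move (hI hi) he (ih (Finset.erase_subset_erase _ hI) (Finset.insert_subset_insert _ hA))

lemma Closings.prepend {f : ι → Clause V} {c : ℕ} {I : Finset ι} {A : Finset V} {l : Lit V}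
    {w : List (ι × Lit V)} (hw : IsWalk f l w) (hn : (walkIdx w).Nodup)
    (hI : ∀ i ∈ walkIdx w, i ∈ I)
    (h : Closings f c (I \ (walkIdx w).toFinset) (A ∪ (walkVars w).toFinset) (walkEnd l w)) :
    Closings f c I A l := by
  induction w generalizing I A l with
  | nil => simpa [walkEnd] using h
  | cons s w ih =>
    simp only [walkIdx, List.map_cons, List.nodup_cons, List.mem_cons, forall_eq_or_imp] at hn hI
    refine .move hI.1 hw.1 (ih hw.2 hn.2 (fun i hi => Finset.mem_erase.2
      ⟨fun e => hn.1 (e ▸ hi), hI.2 i hi⟩) (h.mono ?_ ?_))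
    · intro i; simp; tauto
    · intro i; simp

lemma Closings.prepend_hit {f : ι → Clause V} {c : ℕ} {I : Finset ι} {A : Finset V} {l : Lit V}
    {w : List (ι × Lit V)} (hw : IsWalk f l w) (hn : (walkIdx w).Nodup)
    (hI : ∀ i ∈ walkIdx w, i ∈ I) (hne : w ≠ [])
    (hv : (walkEnd l w).2 ∈ A ∪ (walkVars w.dropLast).toFinset)
    (h : Closings f c (I \ (walkIdx w).toFinset) (A ∪ (walkVars w).toFinset) (walkEnd l w)) :
    Closings f (c + 1) I A l := by
  induction w generalizing I A l with
  | nil => exact absurd rfl hne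
  | cons s w ih =>
    simp only [walkIdx, List.map_cons, List.nodup_cons, List.mem_cons, forall_eq_or_imp] at hn hI
    cases w with
    | nil =>
      simp only [walkEnd, List.dropLast_singleton, walkVars, List.map_nil, List.toFinset_nil,
        Finset.union_empty] at hv
      refine .hit hI.1 hw.1 hv (h.mono ?_ ?_)
      · intro i; simp [Finset.mem_erase]; tauto
      · intro i; simp; rintro (rfl | h); exacts [hv, h]
    | cons t w =>
      refine .move hI.1 hw.1 (ih hw.2 hn.2 (fun i hi => Finset.mem_erase.2
        ⟨fun e => hn.1 (e ▸ hi), hI.2 i hi⟩) (by simp) ?_ (h.mono ?_ ?_))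
      · simp only [walkEnd, List.dropLast_cons_cons, walkVars, List.map_cons, List.toFinset_cons,
          Finset.mem_union, Finset.mem_insert] at hv ⊢
        tauto
      · intro i; simp; tauto
      · intro i; simp; rintro (h | h | h) <;> simp [h]

/-- There is a clause-distinct walk from `l` that passes through some literal and later
through its negation. -/
def SelfContradicting (f : ι → Clause V) (l : Lit V) : Prop :=
  ∃ w w' : List (ι × Lit V), IsWalk f l w ∧ IsWalk f (walkEnd l w) w' ∧
    (walkIdx (w ++ w')).Nodup ∧ walkEnd (walkEnd l w) w' = (walkEnd l w).negate

lemma SelfContradicting.closings_aux {f : ι → Clause V} {l : Lit V} {w w' : List (ι × Lit V)}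
    (h1 : IsWalk f l w) (h2 : IsWalk f (walkEnd l w) w') (h3 : (walkIdx (w ++ w')).Nodup)
    (h4 : walkEnd (walkEnd l w) w' = (walkEnd l w).negate) {I : Finset ι}
    (hI : ∀ i ∈ walkIdx (w ++ w'), i ∈ I) {A : Finset V} (hA : l.2 ∈ A) :
    Closings f 1 I A l := by
  simp only [walkIdx, List.map_append, List.nodup_append, List.mem_append] at h3 hI
  refine .prepend h1 h3.1 (fun i hi => hI i (Or.inl hi)) (.prepend_hit h2 h3.2.1 ?_
    (ne_nil_of_walkEnd_negate h4) ?_ (.zero _ _ _))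
  · intro i hi
    simp only [Finset.mem_sdiff, List.mem_toFinset]
    exact ⟨hI i (Or.inr hi), fun h => h3.2.2 i h i hi rfl⟩
  · rw [h4, Lit.negate_snd]
    apply Finset.mem_union_left
    rcases walkEnd_mem l w with h | h
    · rw [h]; exact Finset.mem_union_left _ hA
    · exact Finset.mem_union_right _ (List.mem_toFinset.2 h)

lemma SelfContradicting.closings [Fintype ι] {f : ι → Clause V} {l : Lit V}
    (h : SelfContradicting f l) : Closings f 1 Finset.univ {l.2} l := by
  obtain ⟨w, w', h1, h2, h3, h4⟩ := h
  exact closings_aux h1 h2 h3 h4 (by simp) (by simp)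

end Trails

section Contradictions

variable {V ι : Type}

lemma exists_split_of_mem_walkIdx {w : List (ι × Lit V)} {i : ι} (h : i ∈ walkIdx w) :
    ∃ a q b, w = a ++ (i, q) :: b := by
  obtain ⟨⟨i', q⟩, hs, rfl⟩ := List.mem_map.1 h
  obtain ⟨a, b, rfl⟩ := List.append_of_mem hs
  exact ⟨a, q, b, rfl⟩

lemma exists_split_first_mem (s : List ι) (w : List (ι × Lit V)) :
    (∀ j ∈ walkIdx w, j ∉ s) ∨
      ∃ a t b, w = a ++ t :: b ∧ t.1 ∈ s ∧ ∀ j ∈ walkIdx a, j ∉ s := by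
  induction w with
  | nil => left; simp
  | cons t w ih =>
    by_cases ht : t.1 ∈ s
    · exact Or.inr ⟨[], t, w, rfl, ht, by simp⟩
    rcases ih with h | ⟨a, t', b, rfl, h1, h2⟩
    · left
      rw [walkIdx, List.map_cons, List.forall_mem_cons]
      exact ⟨ht, h⟩
    · refine Or.inr ⟨t :: a, t', b, rfl, h1, ?_⟩
      rw [walkIdx, List.map_cons, List.forall_mem_cons]
      exact ⟨ht, h2⟩

/-- A walk from `l` either shows that `l` contradicts itself or can be replaced by a
clause-distinct one. -/
lemma trailReach_or_selfContradicting [DecidableEq ι] [Fintype ι] {f : ι → Clause V} {l : Lit V}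
    {w : List (ι × Lit V)} (hw : IsWalk f l w) :
    TrailReach f Finset.univ l (walkEnd l w) ∨ SelfContradicting f l := by
  induction w using List.reverseRecOn with
  | nil => exact Or.inl (TrailReach.refl f _ l)
  | append_singleton w s ih =>
    obtain ⟨i, q⟩ := s
    rw [isWalk_append] at hw
    rw [walkEnd_append]
    change TrailReach f _ l q ∨ _
    rcases ih hw.1 with ⟨t, h1, h2, -, h4⟩ | h
    · have he : clauseEdge (f i) (walkEnd l t) q := h4 ▸ hw.2.1
      by_cases hi : i ∈ walkIdx t
      · obtain ⟨a, q', b, rfl⟩ := exists_split_of_mem_walkIdx hi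
        rw [isWalk_append] at h1
        rw [walkEnd_append] at he
        simp only [walkEnd] at he
        rcases h1.2.1.unique he with ⟨-, rfl⟩ | ⟨-, hq'⟩
        · refine Or.inl ⟨a ++ [(i, q')], ?_, ?_, by simp, by rw [walkEnd_append]; rfl⟩
          · rw [isWalk_append]; exact ⟨h1.1, h1.2.1, trivial⟩
          · refine h2.sublist (List.Sublist.map _ ?_)
            simp
        · right
          refine ⟨a ++ [(i, q')], b, ?_, ?_, ?_, ?_⟩
          · rw [isWalk_append]; exact ⟨h1.1, h1.2.1, trivial⟩
          · rw [walkEnd_append]; exact h1.2.2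
          · simpa using h2
          · rw [walkEnd_append]
            exact (Lit.negate_eq_iff.1 hq'.symm)
      · refine Or.inl ⟨t ++ [(i, q)], ?_, ?_, by simp, by rw [walkEnd_append]; rfl⟩
        · rw [isWalk_append]; exact ⟨h1, he, trivial⟩
        · simp only [walkIdx, List.map_append, List.map_cons, List.map_nil]
          rw [List.nodup_append]
          refine ⟨h2, by simp, ?_⟩
          rintro a ha b hb rfl
          simp at hb
          exact hi (hb ▸ ha)
    · exact Or.inr h

lemma SelfContradicting.exists_walk {f : ι → Clause V} {l : Lit V}
    (h : SelfContradicting f l) : ∃ w, IsWalk f l w ∧ walkEnd l w = l.negate := by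
  obtain ⟨w, w', h1, h2, -, h4⟩ := h
  obtain ⟨r, h5, h6, -⟩ := exists_reverse_walk h1
  refine ⟨w ++ w' ++ r, ?_, ?_⟩
  · rw [isWalk_append, isWalk_append, walkEnd_append, h4]
    exact ⟨⟨h1, h2⟩, h5⟩
  · rw [walkEnd_append, walkEnd_append, h4, h6]

lemma selfContradicting_of_walk [DecidableEq ι] [Fintype ι] {f : ι → Clause V} {l : Lit V}
    {w : List (ι × Lit V)} (hw : IsWalk f l w) (he : walkEnd l w = l.negate) :
    SelfContradicting f l := by
  rcases trailReach_or_selfContradicting hw with ⟨t, h1, h2, -, h4⟩ | h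
  · exact ⟨[], t, trivial, h1, h2, h4.trans he⟩
  · exact h

/-- A trail from `v` through `¬v` to `e`, which meets a clause that maps `e` or
leads to `¬e` on its way, closes twice. -/
lemma closings_two_of_reuse [DecidableEq V] [DecidableEq ι] [Fintype ι]
    {f : ι → Clause V} {v e : Lit V}
    {r r' a b : List (ι × Lit V)} {i : ι} {q : Lit V}
    (hr : IsWalk f v r) (hr' : IsWalk f v.negate r') (hrv : walkEnd v r = v.negate)
    (hre : walkEnd v.negate r' = e) (hn : (walkIdx (r ++ r')).Nodup)
    (hab : r ++ r' = a ++ (i, q) :: b) (hq : walkEnd v a = e ∨ q = e.negate) :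
    Closings f 2 Finset.univ {v.2} v := by
  have hw : IsWalk f v (a ++ (i, q) :: b) := by
    rw [← hab, isWalk_append, hrv]; exact ⟨hr, hr'⟩
  have hend : walkEnd q b = e := by
    have : walkEnd v (a ++ (i, q) :: b) = e := by rw [← hab, walkEnd_append, hrv, hre]
    rwa [walkEnd_append] at this
  have hrne : r ≠ [] := ne_nil_of_walkEnd_negate hrv
  have hn' := hn
  rw [hab] at hn'
  simp only [walkIdx, List.map_append, List.map_cons, List.nodup_append, List.nodup_cons] at hn hn'
  rcases eq_or_ne r' [] with rfl | hne
  · have hev : e = v.negate := hre.symm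
    subst hev
    rw [isWalk_append] at hw
    rcases hq with hq | hq
    · refine .prepend_hit hw.1 hn'.1 (by simp) (ne_nil_of_walkEnd_negate hq) (by simp [hq])
        (.prepend_hit hw.2 ?_ ?_ (by simp) ?_ (.zero _ _ _))
      · simpa using hn'.2.1
      · intro j hj
        simp only [Finset.mem_sdiff, Finset.mem_univ, true_and, List.mem_toFinset]
        exact fun h => hn'.2.2 j h j (by simpa using hj) rfl
      · simp only [walkEnd, hend]
        simp
    · have hqv : q = v := by rw [hq, Lit.negate_negate]
      subst hqv
      have hbne : b ≠ [] := ne_nil_of_walkEnd_negate hend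
      refine .prepend_hit (w := a ++ [(i, q)]) ?_ ?_ (by simp) (by simp)
        (by rw [walkEnd_append]; simp [walkEnd]) (.prepend_hit (w := b) ?_ ?_ ?_ hbne ?_
          (.zero _ _ _))
      · rw [isWalk_append]; exact ⟨hw.1, hw.2.1, trivial⟩
      · simp only [walkIdx, List.map_append, List.map_cons, List.map_nil, List.nodup_append]
        refine ⟨hn'.1, by simp, fun j hj k hk => hn'.2.2 j hj k ?_⟩
        simp only [List.mem_singleton] at hk
        simp [hk]
      · rw [walkEnd_append]; exact hw.2.2
      · exact hn'.2.1.2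
      · intro j hj
        simp only [Finset.mem_sdiff, Finset.mem_univ, true_and, List.mem_toFinset, walkIdx,
          List.map_append, List.map_cons, List.map_nil, List.mem_append, List.mem_singleton]
        rintro (h | rfl)
        · exact hn'.2.2 j h j (List.mem_cons_of_mem _ hj) rfl
        · exact hn'.2.1.1 hj
      · rw [walkEnd_append]
        simp only [walkEnd, hend]
        simp
  · refine .prepend_hit hr hn.1 (by simp) hrne (by simp [hrv]) ?_
    rw [hrv]
    refine .prepend_hit hr' hn.2.1 ?_ hne ?_ (.zero _ _ _)
    · intro j hj
      simp only [Finset.mem_sdiff, Finset.mem_univ, true_and, List.mem_toFinset]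
      exact fun h => hn.2.2 j h j hj rfl
    · rw [hre]
      have hdrop : r ++ r'.dropLast = a ++ ((i, q) :: b).dropLast := by
        rw [← List.dropLast_append_of_ne_nil hne, hab, List.dropLast_append_of_ne_nil (by simp)]
      have hsub : ∀ s ∈ a ++ ((i, q) :: b).dropLast, s.2.2 ∈
          {v.2} ∪ (walkVars r).toFinset ∪ (walkVars r'.dropLast).toFinset := by
        rw [← hdrop]
        intro s hs
        rw [List.mem_append] at hs
        rcases hs with hs | hs
        · exact Finset.mem_union_left _ (Finset.mem_union_right _
            (List.mem_toFinset.2 (List.mem_map.2 ⟨s, hs, rfl⟩)))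
        · exact Finset.mem_union_right _ (List.mem_toFinset.2 (List.mem_map.2 ⟨s, hs, rfl⟩))
      rcases hq with hq | hq
      · rcases walkEnd_mem v a with h | h
        · rw [← hq, h]; simp
        · rw [← hq]
          obtain ⟨s, hs, h⟩ := List.mem_map.1 h
          rw [← h]
          exact hsub s (by simp [hs])
      · have hbne : b ≠ [] := by
          rintro rfl
          exact Lit.negate_ne e (hq.symm.trans hend)
        have := hsub (i, q) (by
          rw [List.mem_append]; right
          cases b with
          | nil => exact absurd rfl hbne
          | cons t b => simp)
        simpa [hq] using this

lemma closings_two_of_selfContradicting [DecidableEq V] [DecidableEq ι] [Fintype ι]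
    {f : ι → Clause V} {x : Lit V}
    (h1 : SelfContradicting f x) (h2 : SelfContradicting f x.negate) :
    ∃ v : Lit V, Closings f 2 Finset.univ {v.2} v := by
  obtain ⟨w1, w2, hw1, hw2, hn, hv⟩ := h1
  obtain ⟨t1, t2, ht1, ht2, hm, hz⟩ := h2
  obtain ⟨r', hr', hre, hi'⟩ := exists_reverse_walk hw1
  obtain ⟨r, hr, hrv, hi⟩ := exists_reverse_walk hw2
  set v := walkEnd x w1 with hvdef
  rw [hv, Lit.negate_negate] at hr hrv
  have hnr : (walkIdx (r ++ r')).Nodup := by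
    have : walkIdx (r ++ r') = (walkIdx (w1 ++ w2)).reverse := by
      simp only [walkIdx] at hi hi' ⊢
      simp [hi, hi']
    rw [this]
    exact List.nodup_reverse.2 hn
  have hnr' := hnr
  simp only [walkIdx, List.map_append, List.nodup_append] at hnr'
  refine ⟨v, ?_⟩
  have key : Closings f 1 ((Finset.univ \ (walkIdx r).toFinset) \ (walkIdx r').toFinset)
      ({v.2} ∪ (walkVars r).toFinset ∪ (walkVars r').toFinset) x.negate →
      Closings f 2 Finset.univ {v.2} v := by
    intro h
    refine .prepend_hit hr hnr'.1 (by simp) (ne_nil_of_walkEnd_negate hrv) (by simp [hrv]) ?_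
    rw [hrv]
    refine .prepend hr' hnr'.2.1 ?_ (by rwa [hre])
    intro j hj
    simp only [Finset.mem_sdiff, Finset.mem_univ, true_and, List.mem_toFinset]
    exact fun h => hnr'.2.2 j h j hj rfl
  have hidx : ∀ j, j ∉ walkIdx (r ++ r') →
      j ∈ (Finset.univ \ (walkIdx r).toFinset) \ (walkIdx r').toFinset := by
    intro j hj
    simp only [walkIdx, List.map_append, List.mem_append, not_or] at hj
    simp [hj]
  rcases exists_split_first_mem (walkIdx (r ++ r')) (t1 ++ t2) with h | ⟨a, ⟨i, q⟩, b, hab, hi, ha⟩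
  · refine key (SelfContradicting.closings_aux ht1 ht2 hm hz (fun j hj => hidx j (h j hj)) ?_)
    have := walkEnd_mem v.negate r'
    rw [hre] at this
    rcases this with h | h
    · rw [h]; simp
    · exact Finset.mem_union_right _ (List.mem_toFinset.2 h)
  · have hT : IsWalk f x.negate (a ++ (i, q) :: b) := by
      rw [← hab, isWalk_append]; exact ⟨ht1, ht2⟩
    rw [isWalk_append] at hT
    obtain ⟨c, q', d, hcd⟩ := exists_split_of_mem_walkIdx hi
    have hS : IsWalk f v (c ++ (i, q') :: d) := by
      rw [← hcd, isWalk_append, hrv]; exact ⟨hr, hr'⟩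
    rw [isWalk_append] at hS
    have huniq := hS.2.1.unique hT.2.1
    rcases eq_or_ne a [] with rfl | hane
    · refine closings_two_of_reuse hr hr' hrv hre hnr hcd ?_
      rcases huniq with ⟨h, -⟩ | ⟨-, h⟩
      · exact Or.inl h
      · exact Or.inr h
    · refine key (.prepend_hit hT.1 ?_ (fun j hj => hidx j (ha j hj)) hane ?_ (.zero _ _ _))
      · rw [hab] at hm
        simp only [walkIdx, List.map_append, List.nodup_append] at hm
        exact hm.1
      · apply Finset.mem_union_left
        have hsub : ∀ s ∈ c ++ (i, q') :: d, s.2.2 ∈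
            {v.2} ∪ (walkVars r).toFinset ∪ (walkVars r').toFinset := by
          rw [← hcd]
          intro s hs
          rw [List.mem_append] at hs
          rcases hs with hs | hs
          · exact Finset.mem_union_left _ (Finset.mem_union_right _
              (List.mem_toFinset.2 (List.mem_map.2 ⟨s, hs, rfl⟩)))
          · exact Finset.mem_union_right _ (List.mem_toFinset.2 (List.mem_map.2 ⟨s, hs, rfl⟩))
        rcases huniq with ⟨h, -⟩ | ⟨-, h⟩
        · rw [← h]
          rcases walkEnd_mem v c with h | h
          · rw [h]; simp
          · obtain ⟨s, hs, h⟩ := List.mem_map.1 h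
            rw [← h]
            exact hsub s (by simp [hs])
        · have := hsub (i, q') (by simp)
          have hsnd : q' = (walkEnd x.negate a).negate := h
          rw [hsnd] at this
          exact this

end Contradictions

section GoodAssignment

variable {V : Type} [Fintype V] {ι : Type}

/-- The literals reachable from `l` in the implication digraph. -/
noncomputable def reachSet (f : ι → Clause V) (l : Lit V) : Finset (Lit V) :=
  Finset.univ.filter fun y => ∃ w, IsWalk f l w ∧ walkEnd l w = y

/-- The literals reachable from `l` by a walk using each clause in `I` at most once. -/
noncomputable def trailSet (f : ι → Clause V) (I : Finset ι) (l : Lit V) : Finset (Lit V) :=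
  Finset.univ.filter fun y => TrailReach f I l y

lemma mem_trailSet {f : ι → Clause V} {I : Finset ι} {l y : Lit V} :
    y ∈ trailSet f I l ↔ TrailReach f I l y := by
  simp [trailSet]

lemma mem_reachSet {f : ι → Clause V} {l y : Lit V} :
    y ∈ reachSet f l ↔ ∃ w, IsWalk f l w ∧ walkEnd l w = y := by
  simp [reachSet]

lemma mem_reachSet_self (f : ι → Clause V) (l : Lit V) : l ∈ reachSet f l :=
  mem_reachSet.2 ⟨[], trivial, rfl⟩

lemma mem_reachSet_trans {f : ι → Clause V} {l y z : Lit V} (h : y ∈ reachSet f l)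
    (h' : z ∈ reachSet f y) : z ∈ reachSet f l := by
  obtain ⟨w, h1, rfl⟩ := mem_reachSet.1 h
  obtain ⟨w', h2, rfl⟩ := mem_reachSet.1 h'
  exact mem_reachSet.2 ⟨w ++ w', isWalk_append.2 ⟨h1, h2⟩, walkEnd_append ..⟩

lemma mem_reachSet_contra {f : ι → Clause V} {l y : Lit V} (h : y ∈ reachSet f l) :
    l.negate ∈ reachSet f y.negate := by
  obtain ⟨w, h1, rfl⟩ := mem_reachSet.1 h
  obtain ⟨w', h2, h3, -⟩ := exists_reverse_walk h1
  exact mem_reachSet.2 ⟨w', h2, h3⟩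

lemma mem_reachSet_of_edge {f : ι → Clause V} {l y z : Lit V} {i : ι} (h : y ∈ reachSet f l)
    (hi : clauseEdge (f i) y z) : z ∈ reachSet f l :=
  mem_reachSet_trans h (mem_reachSet.2 ⟨[(i, z)], ⟨hi, trivial⟩, rfl⟩)

lemma ucpClosed_reachSet {m : ℕ} (f : Fin m → Clause V) (l : Lit V) :
    ucpClosed (List.ofFn f) (reachSet f l : Set (Lit V)) := by
  intro c hc
  obtain ⟨i, rfl⟩ := (List.mem_ofFn' f c).1 hc
  constructor
  · intro h
    exact mem_reachSet_of_edge h (i := i) (Or.inl ⟨(Lit.negate_negate _).symm, rfl⟩)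
  · intro h
    exact mem_reachSet_of_edge h (i := i) (Or.inr ⟨(Lit.negate_negate _).symm, rfl⟩)

lemma selfContradicting_iff [Fintype ι] {f : ι → Clause V} {l : Lit V} :
    SelfContradicting f l ↔ l.negate ∈ reachSet f l := by
  constructor
  · intro h
    exact mem_reachSet.2 h.exists_walk
  · intro h
    obtain ⟨w, h1, h2⟩ := mem_reachSet.1 h
    exact selfContradicting_of_walk h1 h2

lemma reachSet_eq_trailSet [Fintype ι] {f : ι → Clause V} {l : Lit V}
    (h : ¬ SelfContradicting f l) : reachSet f l = trailSet f Finset.univ l := by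
  ext y
  rw [mem_reachSet, mem_trailSet]
  constructor
  · rintro ⟨w, h1, rfl⟩
    exact (trailReach_or_selfContradicting h1).resolve_right h
  · rintro ⟨w, h1, -, -, h2⟩
    exact ⟨w, h1, h2⟩

lemma SelfContradicting.of_mem [Fintype ι] {f : ι → Clause V} {l y : Lit V}
    (hy : y ∈ reachSet f l) (h : SelfContradicting f y) : SelfContradicting f l := by
  rw [selfContradicting_iff] at h ⊢
  exact mem_reachSet_trans hy (mem_reachSet_trans h (mem_reachSet_contra hy))

/-- The number of literals reachable from `l`, or a larger number if `l` is
contradictory. -/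
noncomputable def reachCost [Fintype ι] (f : ι → Clause V) (l : Lit V) : ℕ :=
  if SelfContradicting f l then Fintype.card (Lit V) + 1 else (reachSet f l).card

lemma reachCost_mono [Fintype ι] {f : ι → Clause V} {l y : Lit V} (hy : y ∈ reachSet f l) :
    reachCost f y ≤ reachCost f l := by
  unfold reachCost
  by_cases hl : SelfContradicting f l
  · rw [if_pos hl]
    split_ifs
    · exact le_rfl
    · exact (Finset.card_le_univ _).trans (Nat.le_succ _)
  · rw [if_neg hl, if_neg fun h => hl (h.of_mem hy)]
    exact Finset.card_le_card fun z hz => mem_reachSet_trans hy hz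

lemma not_selfContradicting_of_reachCost_le [Fintype ι] {f : ι → Clause V} {l : Lit V}
    (hf : ¬ (SelfContradicting f l ∧ SelfContradicting f l.negate))
    (h : reachCost f l ≤ reachCost f l.negate) : ¬ SelfContradicting f l := by
  intro hl
  unfold reachCost at h
  rw [if_pos hl, if_neg fun h' => hf ⟨hl, h'⟩] at h
  have := Finset.card_le_univ (reachSet f l.negate)
  omega

/-- If no literal and its negation both contradict themselves, some closed consistent set
of literals contains a cheaper literal of each variable. -/
lemma exists_cheap_closed [Fintype ι] (f : ι → Clause V)
    (hf : ∀ l, ¬ (SelfContradicting f l ∧ SelfContradicting f l.negate)) :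
    ∃ T : Finset (Lit V), (∀ l ∈ T, reachSet f l ⊆ T) ∧ (∀ l, l ∈ T ↔ l.negate ∉ T) ∧
      ∀ l ∈ T, reachCost f l ≤ reachCost f l.negate := by
  let P : Finset (Lit V) → Prop := fun T => (∀ l ∈ T, reachSet f l ⊆ T) ∧
    (∀ l ∈ T, l.negate ∉ T) ∧ ∀ l ∈ T, reachCost f l ≤ reachCost f l.negate
  obtain ⟨T, hT, hmax⟩ := (Finset.univ.filter P).exists_max_image Finset.card
    ⟨∅, by simp [P]⟩
  simp only [Finset.mem_filter, Finset.mem_univ, true_and] at hT hmax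
  obtain ⟨h1, h2, h3⟩ := hT
  have hadd : ∀ l, reachCost f l ≤ reachCost f l.negate → l.negate ∉ T → l ∈ T := by
    intro l hl hlT
    by_contra hlT'
    have hP : P (T ∪ reachSet f l) := by
      have hcons := not_selfContradicting_of_reachCost_le (hf l) hl
      rw [selfContradicting_iff] at hcons
      have hmix : ∀ y ∈ reachSet f l, y.negate ∉ T := by
        intro y hy hyT
        exact hlT (h1 _ hyT (mem_reachSet_contra hy))
      refine ⟨?_, ?_, ?_⟩
      · intro y hy
        rcases Finset.mem_union.1 hy with hy | hy
        · exact (h1 y hy).trans Finset.subset_union_left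
        · exact fun z hz => Finset.mem_union_right _ (mem_reachSet_trans hy hz)
      · intro y hy hy'
        rcases Finset.mem_union.1 hy with hy | hy <;> rcases Finset.mem_union.1 hy' with hy' | hy'
        · exact h2 y hy hy'
        · exact hmix _ hy' (by simpa using hy)
        · exact hmix _ hy hy'
        · have := mem_reachSet_contra hy'
          rw [Lit.negate_negate] at this
          exact hcons (mem_reachSet_trans hy this)
      · intro y hy
        rcases Finset.mem_union.1 hy with hy | hy
        · exact h3 y hy
        · exact (reachCost_mono hy).trans (hl.trans (reachCost_mono (mem_reachSet_contra hy)))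
    have hlt : T.card < (T ∪ reachSet f l).card := by
      apply Finset.card_lt_card
      refine ⟨Finset.subset_union_left, fun h => hlT' (h ?_)⟩
      exact Finset.mem_union_right _ (mem_reachSet_self f l)
    exact absurd (hmax _ hP) (not_le.2 hlt)
  refine ⟨T, h1, fun l => ⟨h2 l, fun hl => ?_⟩, h3⟩
  rcases le_total (reachCost f l) (reachCost f l.negate) with h | h
  · exact hadd l h hl
  · by_contra hl'
    exact hl (hadd l.negate (by simpa using h) (by simpa using hl'))

/-- An upper bound on the expected number of flips: the main term `∑ r(l) r(¬l)` and a
correction for literals that contradict themselves. -/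
lemma wsExp_wsT_le_of_not_closings [DecidableEq V] {m : ℕ} (f : Fin m → Clause V)
    (hf : ∀ l : Lit V, ¬ Closings f 2 Finset.univ {l.2} l) :
    wsExp (List.ofFn f) (fun ω => (wsT (List.ofFn f) ω : ℝ)) ≤
      ∑ l : Lit V, ((trailSet f Finset.univ l).card : ℝ) *
          (trailSet f Finset.univ l.negate).card +
        ∑ l : Lit V, if Closings f 1 Finset.univ {l.2} l.negate then
          ((trailSet f Finset.univ l).card : ℝ) ^ 2 else 0 := by
  have hf' : ∀ l, ¬ (SelfContradicting f l ∧ SelfContradicting f l.negate) := by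
    rintro l ⟨h1, h2⟩
    obtain ⟨v, hv⟩ := closings_two_of_selfContradicting h1 h2
    exact hf v hv
  obtain ⟨T, h1, h2, h3⟩ := exists_cheap_closed f hf'
  set τ : V → Bool := fun x => decide ((true, x) ∈ T) with hτdef
  have hτT : ∀ l : Lit V, τ l.2 = l.1 ↔ l ∈ T := by
    rintro ⟨b, x⟩
    cases b
    · rw [h2]; simp [τ, Lit.negate]
    · simp [τ]
  have hτ : cnfSat τ (List.ofFn f) := by
    intro c hc
    obtain ⟨i, rfl⟩ := (List.mem_ofFn' f c).1 hc
    by_contra h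
    simp only [clauseSat, litSat, not_or, hτT] at h
    obtain ⟨ha, hb⟩ := h
    have ha' : (f i).1.negate ∈ T := by
      by_contra h; exact ha ((h2 _).2 h)
    exact hb (h1 _ ha' (mem_reachSet_of_edge (mem_reachSet_self f _) (i := i)
      (Or.inl ⟨(Lit.negate_negate _).symm, rfl⟩)))
  have hmem : ∀ x, (τ x, x) ∈ T := fun x => (hτT (τ x, x)).1 rfl
  refine (wsExp_wsT_le_sum_sq hτ (fun x => reachSet f (τ x, x)) (fun x => ucpClosed_reachSet f _)
    (fun x l hl => (hτT l).2 (h1 _ (hmem x) hl)) (fun x => mem_reachSet_self f _)).trans ?_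
  rw [← Finset.sum_add_distrib, Fintype.sum_prod_type_right]
  refine Finset.sum_le_sum fun x _ => ?_
  refine le_trans ?_ (Finset.single_le_sum
    (f := fun b => ((trailSet f Finset.univ (b, x)).card : ℝ) *
          (trailSet f Finset.univ (Lit.negate (b, x))).card +
        if Closings f 1 Finset.univ {x} (Lit.negate (b, x)) then
          ((trailSet f Finset.univ (b, x)).card : ℝ) ^ 2 else 0) ?_ (Finset.mem_univ (τ x)))
  · have hc := not_selfContradicting_of_reachCost_le (hf' _) (h3 _ (hmem x))
    have hle := h3 _ (hmem x)
    by_cases hn : SelfContradicting f (Lit.negate (τ x, x))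
    · have := hn.closings
      rw [Lit.negate_snd] at this
      rw [if_pos this, reachSet_eq_trailSet hc]
      have : (0 : ℝ) ≤ ((trailSet f Finset.univ (τ x, x)).card : ℝ) *
          (trailSet f Finset.univ (Lit.negate (τ x, x))).card :=
        mul_nonneg (Nat.cast_nonneg _) (Nat.cast_nonneg _)
      linarith
    · unfold reachCost at hle
      rw [if_neg hc, if_neg hn, reachSet_eq_trailSet hc, reachSet_eq_trailSet hn] at hle
      rw [reachSet_eq_trailSet hc, sq]
      have hle' : ((trailSet f Finset.univ (τ x, x)).card : ℝ) ≤
        (trailSet f Finset.univ (Lit.negate (τ x, x))).card := by exact_mod_cast hle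
      have := mul_le_mul_of_nonneg_left hle'
        (Nat.cast_nonneg (α := ℝ) (trailSet f Finset.univ (τ x, x)).card)
      exact this.trans (le_add_of_nonneg_right (ite_nonneg (mul_self_nonneg _) le_rfl))
  · intro b _
    exact add_nonneg (mul_nonneg (Nat.cast_nonneg _) (Nat.cast_nonneg _))
      (ite_nonneg (sq_nonneg _) le_rfl)

end GoodAssignment

section RandomFormula

variable {n m : ℕ}

/-- The 2-clauses on two distinct variables. -/
noncomputable def validClauses (n : ℕ) : Finset (Clause (Fin n)) :=
  Finset.univ.filter fun c => c.1.2 ≠ c.2.2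

lemma mem_validFormulas {f : FSpace n m} :
    f ∈ validFormulas n m ↔ ∀ i, f i ∈ validClauses n := by
  simp [validFormulas, validClauses]

lemma card_validClauses (n : ℕ) : (validClauses n).card = 4 * (n * (n - 1)) := by
  let e : Clause (Fin n) ≃ (Bool × Bool) × (Fin n × Fin n) := Equiv.prodProdProdComm ..
  have : (validClauses n).card =
      ((Finset.univ : Finset (Bool × Bool)) ×ˢ (Finset.univ : Finset (Fin n)).offDiag).card := by
    refine Finset.card_equiv e fun c => ?_
    simp [validClauses, e]
  rw [this, Finset.card_product, Finset.offDiag_card]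
  simp [Nat.mul_sub]

lemma card_validClauses_cast (hn : 2 ≤ n) :
    ((validClauses n).card : ℝ) = 4 * (n * (n - 1)) := by
  rw [card_validClauses]
  push_cast [Nat.cast_sub (show 1 ≤ n by omega)]
  ring

lemma card_validClauses_pos (hn : 2 ≤ n) : (0 : ℝ) < (validClauses n).card := by
  rw [card_validClauses_cast hn]
  have : (2 : ℝ) ≤ n := by exact_mod_cast hn
  have : (0 : ℝ) < n - 1 := by linarith
  positivity

lemma card_validFormulas_pos (hn : 2 ≤ n) : (0 : ℝ) < (validFormulas n m).card := by
  have h : (validClauses n).Nonempty := by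
    rw [← Finset.card_pos]; exact_mod_cast card_validClauses_pos hn
  obtain ⟨c, hc⟩ := h
  have : (validFormulas n m).Nonempty := ⟨fun _ => c, mem_validFormulas.2 fun _ => hc⟩
  exact_mod_cast Finset.card_pos.2 this

lemma update_mem_validFormulas {f : FSpace n m} (hf : f ∈ validFormulas n m) {i : Fin m}
    {c : Clause (Fin n)} (hc : c ∈ validClauses n) :
    Function.update f i c ∈ validFormulas n m := by
  rw [mem_validFormulas] at hf ⊢
  intro j
  rcases eq_or_ne j i with rfl | hj
  · simpa using hc
  · simpa [hj] using hf j

lemma expF_mono {g h : FSpace n m → ℝ} (H : ∀ f ∈ validFormulas n m, g f ≤ h f) :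
    expF n m g ≤ expF n m h :=
  div_le_div_of_nonneg_right (Finset.sum_le_sum H) (Nat.cast_nonneg _)

lemma expF_congr {g h : FSpace n m → ℝ} (H : ∀ f ∈ validFormulas n m, g f = h f) :
    expF n m g = expF n m h := by
  unfold expF; rw [Finset.sum_congr rfl H]

lemma expF_nonneg {g : FSpace n m → ℝ} (H : ∀ f, 0 ≤ g f) : 0 ≤ expF n m g :=
  div_nonneg (Finset.sum_nonneg fun f _ => H f) (Nat.cast_nonneg _)

lemma expF_add (g h : FSpace n m → ℝ) :
    expF n m (fun f => g f + h f) = expF n m g + expF n m h := by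
  unfold expF; rw [Finset.sum_add_distrib, add_div]

lemma expF_sub (g h : FSpace n m → ℝ) :
    expF n m (fun f => g f - h f) = expF n m g - expF n m h := by
  unfold expF; rw [Finset.sum_sub_distrib, sub_div]

lemma expF_mul_left (a : ℝ) (g : FSpace n m → ℝ) :
    expF n m (fun f => a * g f) = a * expF n m g := by
  unfold expF; rw [← Finset.mul_sum, mul_div_assoc]

lemma expF_sum {κ : Type*} (s : Finset κ) (g : κ → FSpace n m → ℝ) :
    expF n m (fun f => ∑ k ∈ s, g k f) = ∑ k ∈ s, expF n m (g k) := by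
  unfold expF; rw [Finset.sum_comm, Finset.sum_div]

lemma expF_const (hn : 2 ≤ n) (a : ℝ) : expF n m (fun _ => a) = a := by
  unfold expF
  rw [Finset.sum_const, nsmul_eq_mul, mul_div_cancel_left₀ _ (card_validFormulas_pos hn).ne']

lemma prF_eq_expF (P : FSpace n m → Prop) :
    prF n m P = expF n m (fun f => if P f then 1 else 0) := by
  unfold prF expF
  rw [Finset.sum_boole]

/-- The functional `F` does not depend on the clause with index `i`. -/
def IgnoresCoord (i : Fin m) (F : FSpace n m → ℝ) : Prop :=
  ∀ f g, (∀ j, j ≠ i → f j = g j) → F f = F g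

lemma IgnoresCoord.update {i : Fin m} {F : FSpace n m → ℝ} (h : IgnoresCoord i F)
    (f : FSpace n m) (c : Clause (Fin n)) : F (Function.update f i c) = F f :=
  h _ _ fun j hj => by simp [hj]

/-- Average over the clause with index `i`. -/
noncomputable def avgCoord (i : Fin m) (g : FSpace n m → ℝ) (f : FSpace n m) : ℝ :=
  (∑ c ∈ validClauses n, g (Function.update f i c)) / (validClauses n).card

lemma avgCoord_ignores (i : Fin m) (g : FSpace n m → ℝ) : IgnoresCoord i (avgCoord i g) := by
  intro f f' h
  unfold avgCoord
  congr 1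
  refine Finset.sum_congr rfl fun c _ => congrArg g ?_
  ext1 j
  rcases eq_or_ne j i with rfl | hj
  · simp
  · simp [hj, h j hj]

lemma avgCoord_mul {i : Fin m} {g h : FSpace n m → ℝ} (hh : IgnoresCoord i h) (f : FSpace n m) :
    avgCoord i (fun f => g f * h f) f = avgCoord i g f * h f := by
  unfold avgCoord
  simp_rw [hh.update]
  rw [← Finset.sum_mul, div_mul_eq_mul_div]

lemma expF_avgCoord (hn : 2 ≤ n) (i : Fin m) (g : FSpace n m → ℝ) :
    expF n m (avgCoord i g) = expF n m g := by
  unfold expF avgCoord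
  congr 1
  rw [← Finset.sum_div, div_eq_iff (card_validClauses_pos hn).ne', ← Finset.sum_product']
  have : (∑ f ∈ validFormulas n m, g f) * (validClauses n).card =
      ∑ p ∈ validFormulas n m ×ˢ validClauses n, g p.1 := by
    rw [Finset.sum_product, Finset.sum_mul]
    simp [mul_comm]
  rw [this]
  refine Finset.sum_nbij' (fun p => (Function.update p.1 i p.2, p.1 i))
    (fun p => (Function.update p.1 i p.2, p.1 i)) ?_ ?_ ?_ ?_ ?_
  · rintro ⟨f, c⟩ h
    rw [Finset.mem_product] at h ⊢
    exact ⟨update_mem_validFormulas h.1 h.2, mem_validFormulas.1 h.1 i⟩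
  · rintro ⟨f, c⟩ h
    rw [Finset.mem_product] at h ⊢
    exact ⟨update_mem_validFormulas h.1 h.2, mem_validFormulas.1 h.1 i⟩
  · rintro ⟨f, c⟩ _; simp
  · rintro ⟨f, c⟩ _; simp
  · rintro ⟨f, c⟩ _; rfl

/-- Conditioning on the clause with index `i`. -/
lemma expF_coord_le (hn : 2 ≤ n) {i : Fin m} {F : Clause (Fin n) → FSpace n m → ℝ} {K : ℝ}
    (hF : ∀ c, IgnoresCoord i (F c)) (hK : ∀ c ∈ validClauses n, expF n m (F c) ≤ K) :
    expF n m (fun f => F (f i) f) ≤ K := by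
  rw [← expF_avgCoord hn i]
  have : avgCoord i (fun f => F (f i) f) = fun f => ((validClauses n).card : ℝ)⁻¹ *
      ∑ c ∈ validClauses n, F c f := by
    ext f
    simp [avgCoord, (hF _).update, div_eq_inv_mul]
  rw [this, expF_mul_left, expF_sum]
  rw [inv_mul_le_iff₀ (card_validClauses_pos hn)]
  exact (Finset.sum_le_sum hK).trans (by simp)

lemma card_filter_clauseEdge_le (l l' : Lit (Fin n)) :
    (((validClauses n).filter fun c => clauseEdge c l l').card : ℝ) ≤
      if l'.2 ≠ l.2 then 2 else 0 := by
  split_ifs with h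
  · have : ((validClauses n).filter fun c => clauseEdge c l l') ⊆
        {(l.negate, l'), (l', l.negate)} := by
      intro c hc
      rcases (Finset.mem_filter.1 hc).2 with ⟨h1, h2⟩ | ⟨h1, h2⟩
      · simp [← h1, ← h2]
      · simp [← h1, ← h2]
    exact_mod_cast (Finset.card_le_card this).trans Finset.card_le_two
  · push Not at h
    have : ((validClauses n).filter fun c => clauseEdge c l l') = ∅ := by
      ext c
      simp only [validClauses, Finset.mem_filter, Finset.mem_univ, true_and, Finset.notMem_empty,
        iff_false, not_and]
      rintro hc (⟨h1, h2⟩ | ⟨h1, h2⟩)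
      · exact hc (by rw [h1, h2, h]; rfl)
      · exact hc (by rw [h1, h2, h]; rfl)
    simp [this]

lemma expF_edge_mul_le (hn : 2 ≤ n) {i : Fin m} (l l' : Lit (Fin n)) {Y : FSpace n m → ℝ}
    (hY : IgnoresCoord i Y) (h0 : ∀ f, 0 ≤ Y f) :
    expF n m (fun f => (if clauseEdge (f i) l l' then 1 else 0) * Y f) ≤
      (if l'.2 ≠ l.2 then 1 else 0) / (2 * (n * (n - 1))) * expF n m Y := by
  have hn' : (2 : ℝ) ≤ n := by exact_mod_cast hn
  have hn1 : (0 : ℝ) < n - 1 := by linarith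
  rw [← expF_avgCoord hn i, ← expF_mul_left]
  refine expF_mono fun f _ => ?_
  rw [avgCoord_mul hY]
  refine mul_le_mul_of_nonneg_right ?_ (h0 f)
  unfold avgCoord
  simp only [Function.update_self]
  rw [Finset.sum_boole, card_validClauses_cast hn, div_le_div_iff₀ (by positivity) (by positivity)]
  have := card_filter_clauseEdge_le l l'
  have hpos : (0 : ℝ) < 2 * (n * (n - 1)) := by positivity
  refine (mul_le_mul_of_nonneg_right this hpos.le).trans ?_
  split_ifs <;> nlinarith

/-- One step of the exploration: if `G` is bounded by `Z` plus a sum of contributions of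
the implications `l → l'`, so is its expectation. -/
lemma expF_le_of_step (hn : 2 ≤ n) {α : ℝ} (hm : (m : ℝ) ≤ α * n) (I : Finset (Fin m))
    (l : Lit (Fin n)) {G Z : FSpace n m → ℝ} {Y : Fin m → Lit (Fin n) → FSpace n m → ℝ}
    {K : Lit (Fin n) → ℝ}
    (hG : ∀ f ∈ validFormulas n m, G f ≤ Z f +
      ∑ i ∈ I, ∑ l', (if clauseEdge (f i) l l' then 1 else 0) * Y i l' f)
    (hY : ∀ i ∈ I, ∀ l', IgnoresCoord i (Y i l')) (h0 : ∀ i l' f, 0 ≤ Y i l' f)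
    (hK0 : ∀ l', 0 ≤ K l')
    (hK : ∀ i ∈ I, ∀ l', l'.2 ≠ l.2 → expF n m (Y i l') ≤ K l') :
    expF n m G ≤ expF n m Z +
      α / (2 * (n - 1)) * ∑ l' ∈ Finset.univ.filter (fun l' : Lit (Fin n) => l'.2 ≠ l.2), K l' := by
  have hn' : (2 : ℝ) ≤ n := by exact_mod_cast hn
  have hn1 : (0 : ℝ) < n - 1 := by linarith
  refine (expF_mono hG).trans ?_
  rw [expF_add, expF_sum]
  refine add_le_add le_rfl ?_
  set T := ∑ l' ∈ Finset.univ.filter (fun l' : Lit (Fin n) => l'.2 ≠ l.2), K l' with hT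
  have hT0 : 0 ≤ T := Finset.sum_nonneg fun _ _ => hK0 _
  have hstep : ∀ i ∈ I,
      expF n m (fun f => ∑ l', (if clauseEdge (f i) l l' then 1 else 0) * Y i l' f) ≤ 1 / (2 * (n * (n - 1))) * T := by
    intro i hi
    rw [expF_sum, hT, Finset.mul_sum, Finset.sum_filter]
    refine Finset.sum_le_sum fun l' _ => ?_
    refine (expF_edge_mul_le hn l l' (hY i hi l') (h0 i l')).trans ?_
    split_ifs with h
    · exact mul_le_mul_of_nonneg_left (hK i hi l' h) (by positivity)
    · simp
  refine (Finset.sum_le_sum hstep).trans ?_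
  rw [Finset.sum_const, nsmul_eq_mul]
  have hI : (I.card : ℝ) ≤ α * n := by
    refine le_trans ?_ hm
    exact_mod_cast (Finset.card_le_univ I).trans (by simp)
  have : α / (2 * (n - 1)) * T = (α * n) * (1 / (2 * (n * (n - 1))) * T) := by
    field_simp
  rw [this]
  exact mul_le_mul_of_nonneg_right hI (by positivity)

lemma card_filter_snd_ne (l : Lit (Fin n)) (hn : 2 ≤ n) :
    ((Finset.univ.filter (fun l' : Lit (Fin n) => l'.2 ≠ l.2)).card : ℝ) = 2 * (n - 1) := by
  have : (Finset.univ.filter (fun l' : Lit (Fin n) => l'.2 ≠ l.2)) =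
      (Finset.univ : Finset Bool) ×ˢ (Finset.univ.erase l.2) := by
    ext l'; simp
  rw [this, Finset.card_product, Finset.card_erase_of_mem (Finset.mem_univ _)]
  simp [Nat.cast_sub (show 1 ≤ n by omega)]

/-- The uniform case of `expF_le_of_step`. -/
lemma expF_le_of_step_const (hn : 2 ≤ n) {α : ℝ} (hm : (m : ℝ) ≤ α * n) (I : Finset (Fin m))
    (l : Lit (Fin n)) {G Z : FSpace n m → ℝ} {Y : Fin m → Lit (Fin n) → FSpace n m → ℝ}
    {K : ℝ}
    (hG : ∀ f ∈ validFormulas n m, G f ≤ Z f +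
      ∑ i ∈ I, ∑ l', (if clauseEdge (f i) l l' then 1 else 0) * Y i l' f)
    (hY : ∀ i ∈ I, ∀ l', IgnoresCoord i (Y i l')) (h0 : ∀ i l' f, 0 ≤ Y i l' f)
    (hK0 : 0 ≤ K) (hK : ∀ i ∈ I, ∀ l', l'.2 ≠ l.2 → expF n m (Y i l') ≤ K) :
    expF n m G ≤ expF n m Z + α * K := by
  have hn' : (2 : ℝ) ≤ n := by exact_mod_cast hn
  have hn1 : (n - 1 : ℝ) ≠ 0 := by linarith
  refine (expF_le_of_step hn hm I l (K := fun _ => K) hG hY h0 (fun _ => hK0) hK).trans_eq ?_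
  rw [Finset.sum_const, nsmul_eq_mul, card_filter_snd_ne l hn]
  field_simp

end RandomFormula

section TrailCounts

variable {V ι : Type}

lemma trailReach_erase_congr [DecidableEq ι] {f g : ι → Clause V} {i : ι} (h : ∀ j, j ≠ i → f j = g j)
    (I : Finset ι) (l y : Lit V) : TrailReach f (I.erase i) l y ↔ TrailReach g (I.erase i) l y :=
  ⟨fun H => H.congr fun j hj => h j (Finset.ne_of_mem_erase hj),
    fun H => H.congr fun j hj => (h j (Finset.ne_of_mem_erase hj)).symm⟩

variable [Fintype V]

/-- The number of literals reachable from `l` by trails through `I`. -/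
noncomputable def trailCount (f : ι → Clause V) (I : Finset ι) (l : Lit V) : ℝ :=
  (trailSet f I l).card

/-- The literals reachable from some literal in `B` by trails through `I`. -/
noncomputable def trailSetOf (f : ι → Clause V) (I : Finset ι) (B : Finset (Lit V)) :
    Finset (Lit V) :=
  B.biUnion (trailSet f I)

lemma mem_trailSetOf {f : ι → Clause V} {I : Finset ι} {B : Finset (Lit V)} {y : Lit V} :
    y ∈ trailSetOf f I B ↔ ∃ s ∈ B, TrailReach f I s y := by
  simp [trailSetOf, mem_trailSet]

lemma trailSet_mono (f : ι → Clause V) {I J : Finset ι} (h : I ⊆ J) (l : Lit V) :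
    trailSet f I l ⊆ trailSet f J l := fun _ hy =>
  mem_trailSet.2 ((mem_trailSet.1 hy).mono h)

lemma trailCount_nonneg (f : ι → Clause V) (I : Finset ι) (l : Lit V) : 0 ≤ trailCount f I l :=
  Nat.cast_nonneg _

lemma trailCount_mono (f : ι → Clause V) {I J : Finset ι} (h : I ⊆ J) (l : Lit V) :
    trailCount f I l ≤ trailCount f J l :=
  Nat.cast_le.2 (Finset.card_le_card (trailSet_mono f h l))

lemma trailCount_eq_sum (f : ι → Clause V) (I : Finset ι) (l : Lit V) :
    trailCount f I l = ∑ y, if TrailReach f I l y then 1 else 0 := by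
  simp [trailCount, trailSet]

lemma card_trailSetOf_le (f : ι → Clause V) (I : Finset ι) (B : Finset (Lit V)) :
    ((trailSetOf f I B).card : ℝ) ≤ ∑ s ∈ B, trailCount f I s := by
  unfold trailCount trailSetOf
  exact_mod_cast Finset.card_biUnion_le

lemma trailSetOf_mono (f : ι → Clause V) (I : Finset ι) {B B' : Finset (Lit V)} (h : B ⊆ B') :
    trailSetOf f I B ⊆ trailSetOf f I B' :=
  Finset.biUnion_subset_biUnion_of_subset_left _ h

lemma indicator_le_sum_edge {f : ι → Clause V} {I : Finset ι} {l l' : Lit V} {i : ι}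
    (hi : i ∈ I) (he : clauseEdge (f i) l l') {Y : ι → Lit V → ℝ} (hY : ∀ i l', 0 ≤ Y i l') :
    Y i l' ≤ ∑ i ∈ I, ∑ l', (if clauseEdge (f i) l l' then 1 else 0) * Y i l' := by
  have h0 : ∀ i l', 0 ≤ (if clauseEdge (f i) l l' then 1 else 0) * Y i l' := fun i l' =>
    mul_nonneg (ite_nonneg zero_le_one le_rfl) (hY i l')
  calc Y i l' = (if clauseEdge (f i) l l' then 1 else 0) * Y i l' := by rw [if_pos he, one_mul]
    _ ≤ ∑ l', (if clauseEdge (f i) l l' then 1 else 0) * Y i l' :=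
      Finset.single_le_sum (f := fun l' => (if clauseEdge (f i) l l' then 1 else 0) * Y i l')
        (fun l' _ => h0 i l') (Finset.mem_univ l')
    _ ≤ _ := Finset.single_le_sum
        (f := fun i => ∑ l', (if clauseEdge (f i) l l' then 1 else 0) * Y i l')
        (fun i _ => Finset.sum_nonneg fun l' _ => h0 i l') hi

variable [DecidableEq ι]

lemma trailSet_erase_congr {f g : ι → Clause V} {i : ι} (h : ∀ j, j ≠ i → f j = g j)
    (I : Finset ι) (l : Lit V) : trailSet f (I.erase i) l = trailSet g (I.erase i) l := by
  ext y
  rw [mem_trailSet, mem_trailSet, trailReach_erase_congr h]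

lemma trailCount_erase_congr {f g : ι → Clause V} {i : ι} (h : ∀ j, j ≠ i → f j = g j)
    (I : Finset ι) (l : Lit V) : trailCount f (I.erase i) l = trailCount g (I.erase i) l := by
  unfold trailCount
  rw [trailSet_erase_congr h]

lemma indicator_trailReach_le (f : ι → Clause V) (I : Finset ι) (l y : Lit V) :
    (if TrailReach f I l y then (1 : ℝ) else 0) ≤ (if y = l then 1 else 0) +
      ∑ i ∈ I, ∑ l', (if clauseEdge (f i) l l' then 1 else 0) *
        (if TrailReach f (I.erase i) l' y then 1 else 0) := by
  have h0 : 0 ≤ ∑ i ∈ I, ∑ l', (if clauseEdge (f i) l l' then (1 : ℝ) else 0) *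
      (if TrailReach f (I.erase i) l' y then 1 else 0) :=
    Finset.sum_nonneg fun i _ => Finset.sum_nonneg fun l' _ =>
      mul_nonneg (ite_nonneg zero_le_one le_rfl) (ite_nonneg zero_le_one le_rfl)
  by_cases h : TrailReach f I l y
  · rw [if_pos h]
    rcases h.first_step with rfl | ⟨i, hi, l', he, h'⟩
    · rw [if_pos rfl]; linarith
    · have := indicator_le_sum_edge hi he
        (Y := fun i l' => if TrailReach f (I.erase i) l' y then 1 else 0)
        (fun i l' => ite_nonneg zero_le_one le_rfl)
      simp only [if_pos h'] at this
      have h1 : (0 : ℝ) ≤ if y = l then 1 else 0 := ite_nonneg zero_le_one le_rfl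
      linarith
  · rw [if_neg h]
    exact add_nonneg (ite_nonneg zero_le_one le_rfl) h0

/-- A sum over the literals reachable from `l` is split according to the first step. -/
lemma sum_trailSet_le (f : ι → Clause V) (I : Finset ι) (l : Lit V) {g : Lit V → ℝ}
    (hg : ∀ z, 0 ≤ g z) :
    ∑ z ∈ trailSet f I l, g z ≤ g l + ∑ i ∈ I, ∑ l', (if clauseEdge (f i) l l' then 1 else 0) *
      ∑ z ∈ trailSet f (I.erase i) l', g z := by
  have hsum : ∀ (J : Finset ι) (k : Lit V), ∑ z ∈ trailSet f J k, g z =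
      ∑ z, (if TrailReach f J k z then 1 else 0) * g z := by
    intro J k
    rw [trailSet, Finset.sum_filter]
    exact Finset.sum_congr rfl fun z _ => by split_ifs <;> simp
  simp_rw [hsum]
  refine (Finset.sum_le_sum fun z _ =>
    mul_le_mul_of_nonneg_right (indicator_trailReach_le f I l z) (hg z)).trans_eq ?_
  simp_rw [add_mul, Finset.sum_add_distrib, Finset.sum_mul, Finset.mul_sum]
  congr 1
  · simp
  · rw [Finset.sum_comm]
    refine Finset.sum_congr rfl fun i _ => ?_
    rw [Finset.sum_comm]
    exact Finset.sum_congr rfl fun l' _ => Finset.sum_congr rfl fun z _ => mul_assoc _ _ _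

lemma trailCount_le_step (f : ι → Clause V) (I : Finset ι) (l : Lit V) :
    trailCount f I l ≤ 1 + ∑ i ∈ I, ∑ l', (if clauseEdge (f i) l l' then 1 else 0) *
      trailCount f (I.erase i) l' := by
  simpa [trailCount] using sum_trailSet_le f I l (g := fun _ => 1) fun _ => zero_le_one

lemma trailSetOf_subset_of_edge [DecidableEq V] {f : ι → Clause V} {I : Finset ι} {i : ι}
    {l l' : Lit V} {B : Finset (Lit V)} (he : clauseEdge (f i) l l') (hB : l.negate ∈ B) :
    trailSetOf f I B ⊆ trailSetOf f (I.erase i) (insert l' B) := by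
  intro y hy
  obtain ⟨s, hs, h⟩ := mem_trailSetOf.1 hy
  rw [mem_trailSetOf]
  rcases h.delete_edge he with h | ⟨-, h⟩ | ⟨-, h⟩
  · exact ⟨s, Finset.mem_insert_of_mem hs, h⟩
  · exact ⟨l', Finset.mem_insert_self .., h⟩
  · exact ⟨l.negate, Finset.mem_insert_of_mem hB, h⟩

lemma sum_card_trailSetOf_pow_le [DecidableEq V] (f : ι → Clause V) (I : Finset ι) {l : Lit V}
    {B : Finset (Lit V)} (k : ℕ) (hl : l ∈ B) (hl' : l.negate ∈ B) :
    ∑ z ∈ trailSet f I l, ((trailSetOf f I (insert z B)).card : ℝ) ^ k ≤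
      ((trailSetOf f I B).card : ℝ) ^ k +
        ∑ i ∈ I, ∑ l', (if clauseEdge (f i) l l' then 1 else 0) *
          ∑ z ∈ trailSet f (I.erase i) l',
            ((trailSetOf f (I.erase i)
              (insert z (insert l' (insert l'.negate B)))).card : ℝ) ^ k := by
  refine (sum_trailSet_le f I l fun z => by positivity).trans ?_
  rw [Finset.insert_eq_of_mem hl]
  refine add_le_add le_rfl (Finset.sum_le_sum fun i _ => Finset.sum_le_sum fun l' _ => ?_)
  by_cases he : clauseEdge (f i) l l'
  · rw [if_pos he, one_mul, one_mul]
    refine Finset.sum_le_sum fun z _ => ?_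
    gcongr
    refine (trailSetOf_subset_of_edge he (Finset.mem_insert_of_mem hl')).trans
      (trailSetOf_mono f _ ?_)
    intro y
    simp only [Finset.mem_insert]
    tauto
  · simp [he]

end TrailCounts

section Moments

variable {α : ℝ}

lemma exists_pow_le_mul_pow (k : ℕ) {γ : ℝ} (hγ : 1 < γ) :
    ∃ C : ℝ, 0 ≤ C ∧ ∀ b : ℕ, (b : ℝ) ^ k ≤ C * γ ^ b := by
  obtain ⟨C, hC⟩ := (tendsto_pow_const_div_const_pow_of_one_lt k hγ).bddAbove_range
  have h : ∀ b : ℕ, (b : ℝ) ^ k / γ ^ b ≤ C := fun b => hC ⟨b, rfl⟩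
  refine ⟨C, (by positivity : (0 : ℝ) ≤ (0 : ℕ) ^ k / γ ^ 0).trans (h 0), fun b => ?_⟩
  rw [← div_le_iff₀ (by positivity)]
  exact h b

lemma exists_one_lt_mul_sq_lt_one (hα0 : 0 ≤ α) (hα : α < 1) :
    ∃ γ : ℝ, 1 < γ ∧ α * γ ^ 2 < 1 := by
  refine ⟨1 + (1 - α) / 4, by linarith, ?_⟩
  nlinarith [mul_nonneg hα0 (sub_nonneg.2 hα.le), mul_nonneg hα0 hα0,
    mul_nonneg (mul_nonneg hα0 hα0) (sub_nonneg.2 hα.le)]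

/-- `M` bounds the `k`-th moment of the number of literals reachable by trails. -/
def MomentBound (α : ℝ) (k : ℕ) (M : ℝ) : Prop :=
  ∀ n m : ℕ, 2 ≤ n → (m : ℝ) ≤ α * n → ∀ (I : Finset (Fin m)) (l : Lit (Fin n)),
    expF n m (fun f => trailCount f I l ^ k) ≤ M

lemma momentBound_one (hα : α < 1) : MomentBound α 1 (1 / (1 - α)) := by
  intro n m hn hm I l
  simp only [pow_one]
  have h1 : 0 < 1 - α := by linarith
  induction I using Finset.strongInduction generalizing l with
  | H I ih =>
    refine (expF_le_of_step_const hn hm I l (fun f _ => trailCount_le_step f I l)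
      (fun i _ l' f g h => trailCount_erase_congr h I l') (fun i l' f => trailCount_nonneg _ _ _)
      (by positivity) (fun i hi l' _ => ih _ (Finset.erase_ssubset hi) l')).trans_eq ?_
    rw [expF_const hn]
    field_simp
    ring

lemma expF_card_trailSetOf_pow_le {k : ℕ} {M : ℝ} (hM : MomentBound α (k + 1) M) {n m : ℕ}
    (hn : 2 ≤ n) (hm : (m : ℝ) ≤ α * n) (I : Finset (Fin m)) (B : Finset (Lit (Fin n))) :
    expF n m (fun f => ((trailSetOf f I B).card : ℝ) ^ (k + 1)) ≤ M * B.card ^ (k + 1) := by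
  have h : ∀ f ∈ validFormulas n m, ((trailSetOf f I B).card : ℝ) ^ (k + 1) ≤
      (B.card : ℝ) ^ k * ∑ s ∈ B, trailCount f I s ^ (k + 1) := by
    intro f _
    rcases B.eq_empty_or_nonempty with rfl | hB
    · simp [trailSetOf]
    refine (pow_le_pow_left₀ (Nat.cast_nonneg _) (card_trailSetOf_le f I B) _).trans ?_
    have hpos : (0 : ℝ) < (B.card : ℝ) ^ k := by
      have : (0 : ℝ) < B.card := by exact_mod_cast Finset.card_pos.2 hB
      positivity
    have := pow_sum_div_card_le_sum_pow (s := B) (f := trailCount f I)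
      (fun s _ => trailCount_nonneg f I s) k
    rwa [div_le_iff₀' hpos] at this
  refine (expF_mono h).trans ?_
  rw [expF_mul_left, expF_sum]
  refine (mul_le_mul_of_nonneg_left (Finset.sum_le_sum fun s _ => hM n m hn hm I s)
    (by positivity)).trans_eq ?_
  rw [Finset.sum_const, nsmul_eq_mul]
  ring

/-- The joint exploration from `l` and from one of the literals reached from it. -/
lemma exists_expF_sum_trailSet_le (hα0 : 0 ≤ α) (hα : α < 1) {k : ℕ} {M : ℝ} (hM0 : 0 ≤ M)
    (hM : MomentBound α (k + 1) M) :
    ∃ M' : ℝ, 0 ≤ M' ∧ ∀ n m : ℕ, 2 ≤ n → (m : ℝ) ≤ α * n → ∀ (I : Finset (Fin m))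
      (l : Lit (Fin n)), expF n m (fun f => ∑ z ∈ trailSet f I l,
        ((trailSetOf f I (insert z {l, l.negate})).card : ℝ) ^ (k + 1)) ≤ M' := by
  obtain ⟨γ, hγ1, hγ⟩ := exists_one_lt_mul_sq_lt_one hα0 hα
  obtain ⟨C, hC0, hC⟩ := exists_pow_le_mul_pow (k + 1) hγ1
  have hpos : 0 < 1 - α * γ ^ 2 := by linarith
  set K := M * C / (1 - α * γ ^ 2) with hK
  have hK0 : 0 ≤ K := by positivity
  have key : ∀ n m : ℕ, 2 ≤ n → (m : ℝ) ≤ α * n → ∀ (I : Finset (Fin m)) (l : Lit (Fin n))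
      (B : Finset (Lit (Fin n))), l ∈ B → l.negate ∈ B →
      expF n m (fun f => ∑ z ∈ trailSet f I l,
        ((trailSetOf f I (insert z B)).card : ℝ) ^ (k + 1)) ≤ K * γ ^ B.card := by
    intro n m hn hm I
    induction I using Finset.strongInduction with
    | H I ih =>
      intro l B hl hl'
      refine (expF_le_of_step_const hn hm I l (K := K * γ ^ (B.card + 2))
        (Z := fun f => ((trailSetOf f I B).card : ℝ) ^ (k + 1))
        (Y := fun i l' f => ∑ z ∈ trailSet f (I.erase i) l', ((trailSetOf f (I.erase i)
          (insert z (insert l' (insert l'.negate B)))).card : ℝ) ^ (k + 1))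
        (fun f _ => sum_card_trailSetOf_pow_le f I (k + 1) hl hl') ?_ ?_ ?_ ?_).trans ?_
      · intro i _ l' f g h
        simp only [trailSetOf]
        rw [trailSet_erase_congr h, funext (trailSet_erase_congr h I)]
      · exact fun i l' f => Finset.sum_nonneg fun z _ => pow_nonneg (Nat.cast_nonneg _) _
      · positivity
      · intro i hi l' _
        refine (ih _ (Finset.erase_ssubset hi) l' _ (Finset.mem_insert_self ..)
          (Finset.mem_insert_of_mem (Finset.mem_insert_self ..))).trans ?_
        gcongr
        · exact hγ1.le
        · exact (Finset.card_insert_le _ _).trans (Nat.succ_le_succ (Finset.card_insert_le _ _))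
      · calc _ ≤ M * B.card ^ (k + 1) + α * (K * γ ^ (B.card + 2)) := by
              gcongr
              exact expF_card_trailSetOf_pow_le hM hn hm I B
          _ ≤ M * (C * γ ^ B.card) + α * (K * γ ^ (B.card + 2)) := by
              gcongr
              exact hC _
          _ = K * γ ^ B.card := by
              have : M * C = K * (1 - α * γ ^ 2) := by rw [hK]; field_simp
              rw [← mul_assoc, this]
              ring
  refine ⟨K * γ ^ 2, by positivity, fun n m hn hm I l => (key n m hn hm I l _ ?_ ?_).trans ?_⟩
  · simp
  · simp
  · gcongr
    · exact hγ1.le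
    · exact Finset.card_le_two

lemma exists_momentBound (hα0 : 0 ≤ α) (hα : α < 1) (k : ℕ) :
    ∃ M : ℝ, 0 ≤ M ∧ MomentBound α (k + 1) M := by
  induction k with
  | zero =>
    have : 0 < 1 - α := by linarith
    exact ⟨1 / (1 - α), by positivity, momentBound_one hα⟩
  | succ k ih =>
    obtain ⟨M, hM0, hM⟩ := ih
    obtain ⟨M', hM0', hM'⟩ := exists_expF_sum_trailSet_le hα0 hα hM0 hM
    refine ⟨M', hM0', fun n m hn hm I l => le_trans (expF_mono fun f _ => ?_) (hM' n m hn hm I l)⟩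
    rw [pow_succ', trailCount, ← nsmul_eq_mul]
    refine Finset.card_nsmul_le_sum _ _ _ fun z _ => ?_
    gcongr
    intro y hy
    exact mem_trailSetOf.2 ⟨l, by simp, mem_trailSet.1 hy⟩

lemma exists_expF_sum_trailCount_le (hα0 : 0 ≤ α) (hα : α < 1) (k : ℕ) :
    ∃ M : ℝ, 0 ≤ M ∧ ∀ n m : ℕ, 2 ≤ n → (m : ℝ) ≤ α * n → ∀ (I : Finset (Fin m))
      (l : Lit (Fin n)), expF n m (fun f => ∑ z ∈ trailSet f I l,
        trailCount f I z ^ (k + 1)) ≤ M := by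
  obtain ⟨M, hM0, hM⟩ := exists_momentBound hα0 hα k
  obtain ⟨M', hM0', hM'⟩ := exists_expF_sum_trailSet_le hα0 hα hM0 hM
  refine ⟨M', hM0', fun n m hn hm I l => le_trans (expF_mono fun f _ => ?_) (hM' n m hn hm I l)⟩
  refine Finset.sum_le_sum fun z _ => ?_
  unfold trailCount
  gcongr
  intro y hy
  exact mem_trailSetOf.2 ⟨z, by simp, mem_trailSet.1 hy⟩

/-- Two given distinct literals are unlikely to be connected. -/
lemma expF_trailReach_le (hα0 : 0 ≤ α) {M : ℝ} (hM : MomentBound α 1 M) {n m : ℕ}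
    (hn : 2 ≤ n) (hm : (m : ℝ) ≤ α * n) (I : Finset (Fin m)) {l y : Lit (Fin n)} (hly : y ≠ l) :
    expF n m (fun f => if TrailReach f I l y then 1 else 0) ≤ α * M / (2 * (n - 1)) := by
  have hn' : (2 : ℝ) ≤ n := by exact_mod_cast hn
  have hn1 : (0 : ℝ) < n - 1 := by linarith
  have hnn : ∀ (J : Finset (Fin m)) (l : Lit (Fin n)) (f : FSpace n m),
      (0 : ℝ) ≤ if TrailReach f J l y then 1 else 0 :=
    fun J l f => ite_nonneg zero_le_one le_rfl
  refine (expF_le_of_step hn hm I l (Z := fun _ => 0)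
    (Y := fun i l' f => if TrailReach f (I.erase i) l' y then 1 else 0)
    (K := fun l' => expF n m (fun f => if TrailReach f I l' y then 1 else 0))
    (fun f _ => ?_) ?_ (fun i l' f => hnn _ _ f) (fun l' => expF_nonneg (hnn _ _)) ?_).trans ?_
  · have := indicator_trailReach_le f I l y
    rwa [if_neg hly] at this
  · intro i _ l' f g h
    simp only [trailReach_erase_congr h]
  · intro i _ l' _
    refine expF_mono fun f _ => ?_
    split_ifs with h1 h2
    · exact le_rfl
    · exact absurd (h1.mono (Finset.erase_subset _ _)) h2
    · exact zero_le_one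
    · exact le_rfl
  · rw [expF_const hn, zero_add, mul_div_right_comm]
    refine mul_le_mul_of_nonneg_left ?_ (by positivity)
    calc _ ≤ ∑ l', expF n m (fun f => if TrailReach f I l' y then 1 else 0) :=
          Finset.sum_le_sum_of_subset_of_nonneg (Finset.filter_subset _ _)
            fun l' _ _ => expF_nonneg (hnn _ _)
      _ = expF n m (fun f => trailCount f I y.negate ^ 1) := by
          rw [← expF_sum]
          refine expF_congr fun f _ => ?_
          rw [pow_one, trailCount_eq_sum]
          refine Finset.sum_nbij' Lit.negate Lit.negate (by simp) (by simp) (by simp) (by simp) ?_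
          intro l' _
          congr 1
          exact propext ⟨fun h => h.contra, fun h => by simpa using h.contra⟩
      _ ≤ M := hM n m hn hm I _

end Moments

section ClosingProbabilities

lemma closings_erase_congr {V ι : Type} [DecidableEq V] [DecidableEq ι] {f g : ι → Clause V}
    {i : ι} (h : ∀ j, j ≠ i → f j = g j) (c : ℕ) (I : Finset ι) (A : Finset V) (l : Lit V) :
    Closings f c (I.erase i) A l ↔ Closings g c (I.erase i) A l :=
  ⟨fun H => H.congr fun j hj => h j (Finset.ne_of_mem_erase hj),
    fun H => H.congr fun j hj => (h j (Finset.ne_of_mem_erase hj)).symm⟩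

lemma indicator_closings_le {V ι : Type} [Fintype V] [DecidableEq V] [DecidableEq ι]
    (f : ι → Clause V) (c : ℕ) (I : Finset ι) (A : Finset V) (l : Lit V) :
    (if Closings f (c + 1) I A l then (1 : ℝ) else 0) ≤
      ∑ i ∈ I, ∑ l', (if clauseEdge (f i) l l' then 1 else 0) *
        ((if l'.2 ∈ A then 1 else 0) * (if Closings f c (I.erase i) A l' then 1 else 0) +
          (if Closings f (c + 1) (I.erase i) (insert l'.2 A) l' then 1 else 0)) := by
  have h0 : ∀ p : Prop, (0 : ℝ) ≤ if p then 1 else 0 := fun p => ite_nonneg zero_le_one le_rfl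
  have hY : ∀ i l', 0 ≤ (if l'.2 ∈ A then (1 : ℝ) else 0) *
      (if Closings f c (I.erase i) A l' then 1 else 0) +
      (if Closings f (c + 1) (I.erase i) (insert l'.2 A) l' then 1 else 0) := fun i l' =>
    add_nonneg (mul_nonneg (ite_nonneg zero_le_one le_rfl) (h0 _)) (h0 _)
  by_cases h : Closings f (c + 1) I A l
  · rw [if_pos h]
    obtain ⟨i, hi, l', he, h'⟩ := h.first_step
    refine le_trans ?_ (indicator_le_sum_edge hi he hY)
    rcases h' with ⟨hA, h'⟩ | h'
    · rw [if_pos hA, if_pos h', one_mul]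
      exact le_add_of_nonneg_right (h0 _)
    · rw [if_pos h']
      exact le_add_of_nonneg_left (mul_nonneg (ite_nonneg zero_le_one le_rfl) (h0 _))
  · rw [if_neg h]
    exact Finset.sum_nonneg fun i _ => Finset.sum_nonneg fun l' _ =>
      mul_nonneg (ite_nonneg zero_le_one le_rfl) (hY i l')

/-- Each additional closing costs a factor of order `1 / n`. -/
lemma exists_expF_closings_succ_le {α δ δ' K : ℝ} (hα0 : 0 ≤ α) (hδ1 : 1 ≤ δ) (hδ : δ < δ')
    (hδ' : α * δ' < 1) (hK0 : 0 ≤ K) {ε : ℕ → ℝ} (hε : ∀ n, 2 ≤ n → 0 ≤ ε n) {c : ℕ}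
    (hc : ∀ n m : ℕ, 2 ≤ n → (m : ℝ) ≤ α * n → ∀ (I : Finset (Fin m)) (A : Finset (Fin n))
      (l : Lit (Fin n)), expF n m (fun f => if Closings f c I A l then 1 else 0) ≤
        K * δ ^ A.card * ε n) :
    ∃ K' : ℝ, 0 ≤ K' ∧ ∀ n m : ℕ, 2 ≤ n → (m : ℝ) ≤ α * n → ∀ (I : Finset (Fin m))
      (A : Finset (Fin n)) (l : Lit (Fin n)),
      expF n m (fun f => if Closings f (c + 1) I A l then 1 else 0) ≤
        K' * δ' ^ A.card * (ε n / (n - 1)) := by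
  have hδ0 : 0 < δ := by linarith
  have hδ'1 : 1 ≤ δ' := by linarith
  obtain ⟨C, hC0, hC⟩ := exists_pow_le_mul_pow 1 ((one_lt_div hδ0).2 hδ)
  have hC' : ∀ a : ℕ, a * δ ^ a ≤ C * δ' ^ a := by
    intro a
    have := hC a
    rw [pow_one, div_pow, ← mul_div_assoc, le_div_iff₀ (by positivity)] at this
    exact this
  have hpos : 0 < 1 - α * δ' := by linarith
  set K' := α * K * C / (1 - α * δ') with hK'
  have hK'0 : 0 ≤ K' := by positivity
  refine ⟨K', hK'0, ?_⟩
  intro n m hn hm I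
  have hn' : (2 : ℝ) ≤ n := by exact_mod_cast hn
  have hn1 : (0 : ℝ) < n - 1 := by linarith
  have hεn := hε n hn
  have h0 : ∀ p : Prop, (0 : ℝ) ≤ if p then 1 else 0 := fun p => ite_nonneg zero_le_one le_rfl
  induction I using Finset.strongInduction with
  | H I ih =>
    intro A l
    set a := A.card with ha
    refine (expF_le_of_step hn hm I l (Z := fun _ => 0)
      (Y := fun i l' f =>
        (if l'.2 ∈ A then 1 else 0) * (if Closings f c (I.erase i) A l' then 1 else 0) +
          (if Closings f (c + 1) (I.erase i) (insert l'.2 A) l' then 1 else 0))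
      (K := fun l' => (if l'.2 ∈ A then 1 else 0) * (K * δ ^ a * ε n) +
        K' * δ' ^ (a + 1) * (ε n / (n - 1))) ?_ ?_ ?_ ?_ ?_).trans ?_
    · intro f _
      rw [zero_add]
      exact indicator_closings_le f c I A l
    · intro i _ l' f g h
      simp only [closings_erase_congr h]
    · intro i l' f
      exact add_nonneg (mul_nonneg (ite_nonneg zero_le_one le_rfl) (h0 _)) (h0 _)
    · intro l'
      exact add_nonneg (mul_nonneg (ite_nonneg zero_le_one le_rfl) (by positivity)) (by positivity)
    · intro i hi l' _
      rw [expF_add, expF_mul_left]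
      refine add_le_add (mul_le_mul_of_nonneg_left (hc n m hn hm _ A l')
        (ite_nonneg zero_le_one le_rfl)) ?_
      refine (ih _ (Finset.erase_ssubset hi) _ l').trans ?_
      gcongr
      exact Finset.card_insert_le _ _
    · have hsum : ∑ l' ∈ Finset.univ.filter (fun l' : Lit (Fin n) => l'.2 ≠ l.2),
          (if l'.2 ∈ A then (1 : ℝ) else 0) ≤ 2 * a := by
        refine (?_ : _ ≤ ∑ l' : Lit (Fin n), if l'.2 ∈ A then (1 : ℝ) else 0).trans_eq ?_
        · exact Finset.sum_le_sum_of_subset_of_nonneg (Finset.subset_univ _)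
            fun l' _ _ => ite_nonneg zero_le_one le_rfl
        rw [Finset.sum_boole]
        have : (Finset.univ.filter fun l' : Lit (Fin n) => l'.2 ∈ A) =
            (Finset.univ : Finset Bool) ×ˢ A := by
          ext l'; simp
        rw [this, Finset.card_product]
        simp [ha]
      rw [expF_const hn, zero_add, Finset.sum_add_distrib, ← Finset.sum_mul, Finset.sum_const,
        nsmul_eq_mul, card_filter_snd_ne l hn]
      calc _ ≤ α / (2 * (n - 1)) * (2 * a * (K * δ ^ a * ε n) +
            2 * (n - 1) * (K' * δ' ^ (a + 1) * (ε n / (n - 1)))) := by gcongr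
        _ = (α * K * (a * δ ^ a) + α * δ' * K' * δ' ^ a) * (ε n / (n - 1)) := by
            field_simp
            ring
        _ ≤ (α * K * (C * δ' ^ a) + α * δ' * K' * δ' ^ a) * (ε n / (n - 1)) := by
            have := hC' a
            gcongr
        _ = K' * δ' ^ a * (ε n / (n - 1)) := by
            have : α * K * C = K' * (1 - α * δ') := by rw [hK']; field_simp
            linear_combination (δ' ^ a * (ε n / (n - 1))) * this

lemma exists_expF_closings_le {α : ℝ} (hα0 : 0 ≤ α) (hα : α < 1) :
    ∃ K : ℝ, 0 ≤ K ∧ ∀ n m : ℕ, 2 ≤ n → (m : ℝ) ≤ α * n → ∀ (I : Finset (Fin m))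
      (v : Fin n) (l : Lit (Fin n)),
      expF n m (fun f => if Closings f 1 I {v} l then 1 else 0) ≤ K / (n - 1) ∧
      expF n m (fun f => if Closings f 2 I {v} l then 1 else 0) ≤ K / (n - 1) ^ 2 := by
  obtain ⟨γ, hγ1, hγ⟩ := exists_one_lt_mul_sq_lt_one hα0 hα
  have hγ2 : γ < γ ^ 2 := by nlinarith
  have hγ' : α * γ < 1 := by nlinarith
  have hn1 : ∀ n : ℕ, 2 ≤ n → (0 : ℝ) < n - 1 := fun n hn => by
    have : (2 : ℝ) ≤ n := by exact_mod_cast hn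
    linarith
  obtain ⟨K₁, hK₁0, hK₁⟩ := exists_expF_closings_succ_le (c := 0) (ε := fun _ => 1) (K := 1) hα0
    le_rfl hγ1 hγ' zero_le_one (fun _ _ => zero_le_one) (fun n m hn _ I A l => by
      rw [one_pow, mul_one, mul_one]
      exact (expF_mono (h := fun _ => 1) fun f _ => by split_ifs <;> norm_num).trans_eq
        (expF_const hn 1))
  obtain ⟨K₂, hK₂0, hK₂⟩ := exists_expF_closings_succ_le (c := 1) (ε := fun n => 1 / (n - 1))
    hα0 hγ1.le hγ2 hγ hK₁0 (fun n hn => (one_div_pos.2 (hn1 n hn)).le) hK₁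
  refine ⟨max (K₁ * γ) (K₂ * γ ^ 2), le_max_of_le_left (by positivity),
    fun n m hn hm I v l => ⟨?_, ?_⟩⟩
  · have := hK₁ n m hn hm I {v} l
    have h1 := hn1 n hn
    refine this.trans ?_
    rw [Finset.card_singleton, pow_one, mul_one_div]
    gcongr
    exact le_max_left _ _
  · have := hK₂ n m hn hm I {v} l
    have h1 := hn1 n hn
    refine this.trans ?_
    rw [Finset.card_singleton, pow_one, div_div, ← sq, mul_one_div]
    gcongr
    exact le_max_right _ _

end ClosingProbabilities

section Pairs

lemma trailCount_le_of_edge {V ι : Type} [Fintype V] [DecidableEq V] [DecidableEq ι]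
    {f : ι → Clause V} {I : Finset ι} {i : ι} {l l' : Lit V} (he : clauseEdge (f i) l l')
    (y : Lit V) :
    trailCount f I y ≤ trailCount f (I.erase i) y +
      (if TrailReach f (I.erase i) y l then 1 else 0) * trailCount f (I.erase i) l' +
      (if TrailReach f (I.erase i) y l'.negate then 1 else 0) *
        trailCount f (I.erase i) l.negate := by
  simp_rw [trailCount_eq_sum, Finset.mul_sum, ← Finset.sum_add_distrib]
  refine Finset.sum_le_sum fun z _ => ?_
  have h0 : ∀ p : Prop, (0 : ℝ) ≤ if p then 1 else 0 := fun p => ite_nonneg zero_le_one le_rfl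
  have h2 := mul_nonneg (h0 (TrailReach f (I.erase i) y l)) (h0 (TrailReach f (I.erase i) l' z))
  have h3 := mul_nonneg (h0 (TrailReach f (I.erase i) y l'.negate))
    (h0 (TrailReach f (I.erase i) l.negate z))
  have h1 := h0 (TrailReach f (I.erase i) y z)
  by_cases h : TrailReach f I y z
  · rw [if_pos h]
    rcases h.delete_edge he with h | ⟨h, h'⟩ | ⟨h, h'⟩
    · rw [if_pos h]; linarith
    · rw [if_pos h, if_pos h', one_mul] at *; linarith
    · rw [if_pos h, if_pos h', one_mul] at *; linarith
  · rw [if_neg h]; linarith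

lemma trailCount_mul_le_step {V ι : Type} [Fintype V] [DecidableEq V] [DecidableEq ι]
    (f : ι → Clause V) (I : Finset ι) (l y : Lit V) :
    trailCount f I l * trailCount f I y ≤ trailCount f I y +
      ∑ i ∈ I, ∑ l', (if clauseEdge (f i) l l' then 1 else 0) *
        (trailCount f (I.erase i) l' * trailCount f (I.erase i) y +
          (if TrailReach f (I.erase i) y l then 1 else 0) * trailCount f (I.erase i) l' ^ 2 +
          (if TrailReach f (I.erase i) y l'.negate then 1 else 0) *
            (trailCount f (I.erase i) l' * trailCount f (I.erase i) l.negate)) := by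
  refine (mul_le_mul_of_nonneg_right (trailCount_le_step f I l)
    (trailCount_nonneg f I y)).trans ?_
  rw [add_mul, one_mul, Finset.sum_mul]
  refine add_le_add le_rfl (Finset.sum_le_sum fun i _ => ?_)
  rw [Finset.sum_mul]
  refine Finset.sum_le_sum fun l' _ => ?_
  by_cases he : clauseEdge (f i) l l'
  · rw [if_pos he, one_mul, one_mul]
    refine (mul_le_mul_of_nonneg_left (trailCount_le_of_edge he y)
      (trailCount_nonneg f _ l')).trans_eq ?_
    ring
  · simp [he]

lemma expF_indicator_mul_le {n m : ℕ} (P : FSpace n m → Prop) (W : FSpace n m → ℝ) {s : ℝ}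
    (hs : 0 < s) :
    expF n m (fun f => (if P f then 1 else 0) * W f) ≤
      s * expF n m (fun f => if P f then 1 else 0) + s⁻¹ * expF n m (fun f => W f ^ 2) := by
  rw [← expF_mul_left, ← expF_mul_left, ← expF_add]
  refine expF_mono fun f _ => ?_
  split_ifs
  · rw [one_mul, mul_one, inv_mul_eq_div, ← sub_le_iff_le_add', le_div_iff₀ hs]
    nlinarith [sq_nonneg (W f - s), sq_nonneg (W f), sq_nonneg s]
  · rw [zero_mul, mul_zero, zero_add]
    positivity

lemma expF_sq_mul_sq_le {α M : ℝ} (hM : MomentBound α 4 M) {n m : ℕ} (hn : 2 ≤ n)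
    (hm : (m : ℝ) ≤ α * n) (I : Finset (Fin m)) (l y : Lit (Fin n)) :
    expF n m (fun f => (trailCount f I l * trailCount f I y) ^ 2) ≤ M := by
  refine (expF_mono (h := fun f => 2⁻¹ * trailCount f I l ^ 4 + 2⁻¹ * trailCount f I y ^ 4)
    fun f _ => ?_).trans ?_
  · nlinarith [sq_nonneg (trailCount f I l ^ 2 - trailCount f I y ^ 2)]
  · rw [expF_add, expF_mul_left, expF_mul_left]
    linarith [hM n m hn hm I l, hM n m hn hm I y]

lemma expF_mul_le {α M : ℝ} (hM : MomentBound α 2 M) {n m : ℕ} (hn : 2 ≤ n)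
    (hm : (m : ℝ) ≤ α * n) (I : Finset (Fin m)) (l y : Lit (Fin n)) :
    expF n m (fun f => trailCount f I l * trailCount f I y) ≤ M := by
  refine (expF_mono (h := fun f => 2⁻¹ * trailCount f I l ^ 2 + 2⁻¹ * trailCount f I y ^ 2)
    fun f _ => ?_).trans ?_
  · nlinarith [sq_nonneg (trailCount f I l - trailCount f I y)]
  · rw [expF_add, expF_mul_left, expF_mul_left]
    linarith [hM n m hn hm I l, hM n m hn hm I y]

/-- The numbers of literals reachable from two distinct literals are almost uncorrelated. -/
lemma exists_expF_trailCount_mul_le {α : ℝ} (hα0 : 0 ≤ α) (hα : α < 1) :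
    ∃ C : ℝ, 0 ≤ C ∧ ∀ n m : ℕ, 2 ≤ n → (m : ℝ) ≤ α * n → ∀ (I : Finset (Fin m))
      (l y : Lit (Fin n)), y ≠ l →
      expF n m (fun f => trailCount f I l * trailCount f I y) ≤
        1 / (1 - α) ^ 2 + C / √(n - 1) := by
  have hpos : 0 < 1 - α := by linarith
  obtain ⟨M₂, hM₂0, hM₂⟩ := exists_momentBound hα0 hα 1
  obtain ⟨M₄, hM₄0, hM₄⟩ := exists_momentBound hα0 hα 3
  have hM₁ := momentBound_one hα
  set M₁ := 1 / (1 - α) with hM₁def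
  have hM₁0 : 0 ≤ M₁ := by positivity
  set e := α * M₁ / 2 + M₄ with he
  set C := α * (2 * e + M₂) / (1 - α) with hC
  have he0 : 0 ≤ e := by positivity
  have hC0 : 0 ≤ C := by positivity
  refine ⟨C, hC0, fun n m hn hm I => ?_⟩
  have hn' : (2 : ℝ) ≤ n := by exact_mod_cast hn
  have hn1 : (0 : ℝ) < n - 1 := by linarith
  set s := √((n : ℝ) - 1) with hs
  have hs0 : 0 < s := Real.sqrt_pos.2 hn1
  have hs2 : (n : ℝ) - 1 = s ^ 2 := (Real.sq_sqrt hn1.le).symm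
  have hs1 : 1 ≤ s := Real.one_le_sqrt.2 (by linarith)
  have hind : ∀ (J : Finset (Fin m)) (u v : Lit (Fin n)) (W : FSpace n m → ℝ), v ≠ u →
      expF n m (fun f => W f ^ 2) ≤ M₄ →
      expF n m (fun f => (if TrailReach f J u v then 1 else 0) * W f) ≤ e / s := by
    intro J u v W huv hW
    refine (expF_indicator_mul_le _ W hs0).trans ?_
    have h1 := expF_trailReach_le hα0 hM₁ hn hm J huv
    calc _ ≤ s * (α * M₁ / (2 * (n - 1))) + s⁻¹ * M₄ := by gcongr
      _ = e / s := by rw [hs2, he]; field_simp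
  induction I using Finset.strongInduction with
  | H I ih =>
    intro l y hyl
    have h0 : ∀ p : Prop, (0 : ℝ) ≤ if p then 1 else 0 :=
      fun p => ite_nonneg zero_le_one le_rfl
    set b := 1 / (1 - α) ^ 2 + C / s with hb
    have hb0 : 0 ≤ b := by positivity
    refine (expF_le_of_step hn hm I l (Z := fun f => trailCount f I y)
      (Y := fun i l' f => trailCount f (I.erase i) l' * trailCount f (I.erase i) y +
          (if TrailReach f (I.erase i) y l then 1 else 0) * trailCount f (I.erase i) l' ^ 2 +
          (if TrailReach f (I.erase i) y l'.negate then 1 else 0) *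
            (trailCount f (I.erase i) l' * trailCount f (I.erase i) l.negate))
      (K := fun l' => (b + 2 * (e / s)) + if l'.2 = y.2 then M₂ else 0) ?_ ?_ ?_ ?_ ?_).trans ?_
    · exact fun f _ => trailCount_mul_le_step f I l y
    · intro i _ l' f g h
      simp only [trailReach_erase_congr h, trailCount_erase_congr h]
    · intro i l' f
      have := trailCount_nonneg f (I.erase i) l'
      have := trailCount_nonneg f (I.erase i) y
      have := trailCount_nonneg f (I.erase i) l.negate
      have := h0 (TrailReach f (I.erase i) y l)
      have := h0 (TrailReach f (I.erase i) y l'.negate)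
      positivity
    · intro l'
      exact add_nonneg (by positivity) (ite_nonneg hM₂0 le_rfl)
    · intro i hi l' _
      rw [expF_add, expF_add]
      have h2 : expF n m (fun f => (if TrailReach f (I.erase i) y l then 1 else 0) *
          trailCount f (I.erase i) l' ^ 2) ≤ e / s := by
        refine hind _ _ _ _ hyl.symm ?_
        simpa only [← pow_mul] using hM₄ n m hn hm _ l'
      have h3 : ∀ hne : l'.negate ≠ y, expF n m (fun f =>
          (if TrailReach f (I.erase i) y l'.negate then 1 else 0) *
            (trailCount f (I.erase i) l' * trailCount f (I.erase i) l.negate)) ≤ e / s :=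
        fun hne => hind _ _ _ _ hne (expF_sq_mul_sq_le hM₄ hn hm _ _ _)
      have h1 : y ≠ l' → expF n m (fun f =>
          trailCount f (I.erase i) l' * trailCount f (I.erase i) y) ≤ b :=
        ih _ (Finset.erase_ssubset hi) l' y
      have hes : 0 ≤ e / s := by positivity
      rcases eq_or_ne y l' with rfl | hyl'
      · have := h3 (Lit.negate_ne y)
        have := expF_mul_le hM₂ hn hm (I.erase i) y y
        rw [if_pos rfl]
        linarith
      · have h1' := h1 hyl'
        rcases eq_or_ne l'.negate y with h | h
        · have : expF n m (fun f => (if TrailReach f (I.erase i) y l'.negate then 1 else 0) *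
              (trailCount f (I.erase i) l' * trailCount f (I.erase i) l.negate)) ≤ M₂ := by
            refine (expF_mono fun f _ => ?_).trans (expF_mul_le hM₂ hn hm (I.erase i) l' l.negate)
            refine mul_le_of_le_one_left
              (mul_nonneg (trailCount_nonneg _ _ _) (trailCount_nonneg _ _ _)) ?_
            split_ifs <;> norm_num
          rw [if_pos (by rw [← h, Lit.negate_snd])]
          linarith
        · have := h3 h
          have : (0 : ℝ) ≤ if l'.2 = y.2 then M₂ else 0 := ite_nonneg hM₂0 le_rfl
          linarith
    · have hZ : expF n m (fun f => trailCount f I y) ≤ M₁ := by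
        simpa only [pow_one] using hM₁ n m hn hm I y
      have hsum : ∑ l' ∈ Finset.univ.filter (fun l' : Lit (Fin n) => l'.2 ≠ l.2),
          (if l'.2 = y.2 then M₂ else 0) ≤ 2 * M₂ := by
        refine (?_ : _ ≤ ∑ l' : Lit (Fin n), if l'.2 = y.2 then M₂ else 0).trans_eq ?_
        · exact Finset.sum_le_sum_of_subset_of_nonneg (Finset.subset_univ _)
            fun l' _ _ => ite_nonneg hM₂0 le_rfl
        · rw [Fintype.sum_prod_type]
          simp [two_mul]
      rw [Finset.sum_add_distrib, Finset.sum_const, nsmul_eq_mul, card_filter_snd_ne l hn]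
      calc _ ≤ M₁ + α / (2 * (n - 1)) * (2 * (n - 1) * (b + 2 * (e / s)) + 2 * M₂) := by gcongr
        _ = M₁ + α * (b + 2 * (e / s)) + α * M₂ / (n - 1) := by
            field_simp
            ring
        _ ≤ M₁ + α * (b + 2 * (e / s)) + α * M₂ / s := by
            gcongr
            rw [hs2]
            nlinarith
        _ = b := by
            rw [hb, hC, hM₁def]
            field_simp
            ring

/-- The contribution of the literals whose exploration closes up is negligible. -/
lemma exists_expF_closings_mul_sq_le {α : ℝ} (hα0 : 0 ≤ α) (hα : α < 1) :
    ∃ C : ℝ, 0 ≤ C ∧ ∀ n m : ℕ, 2 ≤ n → (m : ℝ) ≤ α * n → ∀ (I : Finset (Fin m))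
      (v : Fin n) (l k : Lit (Fin n)),
      expF n m (fun f => (if Closings f 1 I {v} k then 1 else 0) * trailCount f I l ^ 2) ≤
        C / √(n - 1) := by
  obtain ⟨M, hM0, hM⟩ := exists_momentBound hα0 hα 3
  obtain ⟨K, hK0, hK⟩ := exists_expF_closings_le hα0 hα
  refine ⟨K + M, by positivity, fun n m hn hm I v l k => ?_⟩
  have hn' : (2 : ℝ) ≤ n := by exact_mod_cast hn
  have hn1 : (0 : ℝ) < n - 1 := by linarith
  set s := √((n : ℝ) - 1) with hs
  have hs0 : 0 < s := Real.sqrt_pos.2 hn1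
  have hs2 : (n : ℝ) - 1 = s ^ 2 := (Real.sq_sqrt hn1.le).symm
  refine (expF_indicator_mul_le _ _ hs0).trans ?_
  have h1 := (hK n m hn hm I v k).1
  have h2 : expF n m (fun f => (trailCount f I l ^ 2) ^ 2) ≤ M := by
    simpa only [← pow_mul] using hM n m hn hm I l
  calc _ ≤ s * (K / (n - 1)) + s⁻¹ * M := by gcongr
    _ = (K + M) / s := by rw [hs2]; field_simp

end Pairs

section EfronStein

variable {n m : ℕ}

lemma IgnoresCoord.avgCoord {i j : Fin m} {g : FSpace n m → ℝ} (h : IgnoresCoord j g) :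
    IgnoresCoord j (avgCoord i g) := by
  intro f f' hf
  unfold _root_.avgCoord
  congr 1
  refine Finset.sum_congr rfl fun c _ => h _ _ fun k hk => ?_
  simp only [Function.update_apply, hf k hk]

lemma avgCoord_comm (i j : Fin m) (g : FSpace n m → ℝ) :
    avgCoord i (avgCoord j g) = avgCoord j (avgCoord i g) := by
  rcases eq_or_ne i j with rfl | hij
  · rfl
  ext f
  unfold avgCoord
  simp_rw [← Finset.sum_div]
  rw [Finset.sum_comm]
  simp_rw [Function.update_comm hij]

lemma avgCoord_sub (i : Fin m) (g h : FSpace n m → ℝ) (f : FSpace n m) :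
    avgCoord i (fun f => g f - h f) f = avgCoord i g f - avgCoord i h f := by
  unfold avgCoord
  rw [Finset.sum_sub_distrib, sub_div]

lemma IgnoresCoord.eq_const {F : FSpace n m → ℝ} (h : ∀ i, IgnoresCoord i F)
    (f f' : FSpace n m) : F f = F f' := by
  have : ∀ s : Finset (Fin m), F (s.piecewise f f') = F f' := by
    intro s
    induction s using Finset.induction_on with
    | empty => simp
    | insert j s _ ih => rw [Finset.piecewise_insert, (h j).update, ih]
  simpa using this Finset.univ

lemma expF_mul_eq_avgCoord_mul (hn : 2 ≤ n) {i : Fin m} (g : FSpace n m → ℝ)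
    {h : FSpace n m → ℝ} (hh : IgnoresCoord i h) :
    expF n m (fun f => g f * h f) = expF n m (fun f => avgCoord i g f * h f) := by
  rw [← expF_avgCoord hn i]
  exact expF_congr fun f _ => avgCoord_mul hh f

lemma expF_sub_sq (g h : FSpace n m → ℝ) : expF n m (fun f => (g f - h f) ^ 2) =
    expF n m (fun f => g f ^ 2) - 2 * expF n m (fun f => g f * h f) +
      expF n m (fun f => h f ^ 2) := by
  rw [← expF_mul_left, ← expF_sub, ← expF_add]
  exact expF_congr fun f _ => by ring

lemma expF_sub_avgCoord_sq (hn : 2 ≤ n) (i : Fin m) (g : FSpace n m → ℝ) :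
    expF n m (fun f => (g f - avgCoord i g f) ^ 2) =
      expF n m (fun f => g f ^ 2) - expF n m (fun f => avgCoord i g f ^ 2) := by
  rw [expF_sub_sq, expF_mul_eq_avgCoord_mul hn g (avgCoord_ignores i g)]
  simp_rw [← sq]
  ring

lemma expF_avgCoord_sq_le (hn : 2 ≤ n) (i : Fin m) (g : FSpace n m → ℝ) :
    expF n m (fun f => avgCoord i g f ^ 2) ≤ expF n m (fun f => g f ^ 2) := by
  rw [← sub_nonneg, ← expF_sub_avgCoord_sq hn]
  exact expF_nonneg fun f => sq_nonneg _

lemma expF_sub_avgCoord_sq_le (hn : 2 ≤ n) {i : Fin m} (g : FSpace n m → ℝ)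
    {h : FSpace n m → ℝ} (hh : IgnoresCoord i h) :
    expF n m (fun f => (g f - avgCoord i g f) ^ 2) ≤ expF n m (fun f => (g f - h f) ^ 2) := by
  have h1 := expF_sub_sq g h
  have h2 := expF_sub_sq (avgCoord i g) h
  have h3 := expF_nonneg (n := n) (m := m) fun f => sq_nonneg (avgCoord i g f - h f)
  rw [expF_sub_avgCoord_sq hn, h1, expF_mul_eq_avgCoord_mul hn g hh]
  linarith

lemma expF_foldl_avgCoord (hn : 2 ≤ n) (L : List (Fin m)) (g : FSpace n m → ℝ) :
    expF n m (L.foldl (fun g i => avgCoord i g) g) = expF n m g := by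
  induction L generalizing g with
  | nil => rfl
  | cons i L ih => rw [List.foldl_cons, ih, expF_avgCoord hn]

lemma IgnoresCoord.foldl_avgCoord {j : Fin m} {g : FSpace n m → ℝ} (h : IgnoresCoord j g)
    (L : List (Fin m)) : IgnoresCoord j (L.foldl (fun g i => _root_.avgCoord i g) g) := by
  induction L generalizing g with
  | nil => exact h
  | cons i L ih => exact ih h.avgCoord

lemma foldl_avgCoord_ignores {L : List (Fin m)} {j : Fin m} (hj : j ∈ L) (g : FSpace n m → ℝ) :
    IgnoresCoord j (L.foldl (fun g i => avgCoord i g) g) := by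
  induction L generalizing g with
  | nil => simp at hj
  | cons i L ih =>
    rcases List.mem_cons.1 hj with rfl | hj
    · exact (avgCoord_ignores j g).foldl_avgCoord L
    · exact ih hj _

lemma expF_sq_sub_foldl_avgCoord_le (hn : 2 ≤ n) (L : List (Fin m)) (g : FSpace n m → ℝ) :
    expF n m (fun f => g f ^ 2) -
        expF n m (fun f => L.foldl (fun g i => avgCoord i g) g f ^ 2) ≤
      (L.map fun i => expF n m (fun f => (g f - avgCoord i g f) ^ 2)).sum := by
  induction L generalizing g with
  | nil => simp
  | cons i L ih =>
    rw [List.foldl_cons, List.map_cons, List.sum_cons, expF_sub_avgCoord_sq hn i g]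
    have h : (L.map fun j => expF n m
          (fun f => (avgCoord i g f - avgCoord j (avgCoord i g) f) ^ 2)).sum ≤
        (L.map fun j => expF n m (fun f => (g f - avgCoord j g f) ^ 2)).sum := by
      refine List.sum_le_sum fun j _ => ?_
      rw [avgCoord_comm j i]
      simp_rw [← avgCoord_sub]
      exact expF_avgCoord_sq_le hn i _
    linarith [ih (avgCoord i g)]

/-- The Efron–Stein inequality. -/
lemma expF_sq_sub_sq_expF_le (hn : 2 ≤ n) (g : FSpace n m → ℝ) {h : Fin m → FSpace n m → ℝ}
    (hh : ∀ i, IgnoresCoord i (h i)) :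
    expF n m (fun f => g f ^ 2) - expF n m g ^ 2 ≤
      ∑ i, expF n m (fun f => (g f - h i f) ^ 2) := by
  set P := (List.finRange m).foldl (fun g i => avgCoord i g) g with hP
  have hc : ∀ f f', P f = P f' := IgnoresCoord.eq_const fun i =>
    foldl_avgCoord_ignores (List.mem_finRange i) g
  have hPg : expF n m P = expF n m g := expF_foldl_avgCoord hn _ g
  have hconst : ∀ f, P f = expF n m g := by
    intro f
    rw [← hPg, expF_congr (h := fun _ => P f) fun f' _ => hc f' f, expF_const hn]
  have key := expF_sq_sub_foldl_avgCoord_le hn (List.finRange m) g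
  rw [← hP] at key
  simp_rw [hconst] at key
  rw [expF_const hn, ← Fin.sum_univ_def] at key
  exact key.trans (Finset.sum_le_sum fun i _ => expF_sub_avgCoord_sq_le hn g (hh i))

end EfronStein

section PairSums

/-- The sum over all literals `l` of the product of the numbers of literals reachable from `l`
and from its negation. -/
noncomputable def pairSum {V ι : Type} [Fintype V] (f : ι → Clause V) (I : Finset ι) : ℝ :=
  ∑ l : Lit V, trailCount f I l * trailCount f I l.negate

/-- The bound for the influence of the clause `c` on `pairSum`. -/
noncomputable def influence {V ι : Type} [Fintype V] (f : ι → Clause V) (I : Finset ι)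
    (c : Clause V) : ℝ :=
  320 * (trailCount f I c.1 ^ 6 + trailCount f I c.2 ^ 6) +
    8 * (∑ z ∈ trailSet f I c.1, trailCount f I z ^ 5 +
      ∑ z ∈ trailSet f I c.2, trailCount f I z ^ 5)

lemma sum_negate {V : Type} [Fintype V] (g : Lit V → ℝ) :
    ∑ l : Lit V, g l.negate = ∑ l, g l :=
  Finset.sum_nbij' Lit.negate Lit.negate (by simp) (by simp) (by simp) (by simp) (by simp)

variable {V ι : Type} [Fintype V] [DecidableEq ι]

lemma pairSum_erase_le (f : ι → Clause V) (I : Finset ι) (i : ι) :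
    pairSum f (I.erase i) ≤ pairSum f I :=
  Finset.sum_le_sum fun l _ => mul_le_mul (trailCount_mono f (Finset.erase_subset _ _) l)
    (trailCount_mono f (Finset.erase_subset _ _) _) (trailCount_nonneg _ _ _)
    (trailCount_nonneg _ _ _)

variable [DecidableEq V]

lemma trailCount_le_of_erase (f : ι → Clause V) (I : Finset ι) (i : ι) (y : Lit V) :
    trailCount f I y ≤ trailCount f (I.erase i) y +
      if y.negate ∈ trailSet f (I.erase i) (f i).1 ∪ trailSet f (I.erase i) (f i).2 then
        trailCount f (I.erase i) (f i).1 + trailCount f (I.erase i) (f i).2 else 0 := by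
  have he : clauseEdge (f i) (f i).1.negate (f i).2 := Or.inl ⟨by simp, rfl⟩
  have key := trailCount_le_of_edge (I := I) he y
  rw [Lit.negate_negate] at key
  have h1 : TrailReach f (I.erase i) y (f i).1.negate → y.negate ∈ trailSet f (I.erase i) (f i).1 :=
    fun h => mem_trailSet.2 (by simpa using h.contra)
  have h2 : TrailReach f (I.erase i) y (f i).2.negate → y.negate ∈ trailSet f (I.erase i) (f i).2 :=
    fun h => mem_trailSet.2 (by simpa using h.contra)
  have ha := trailCount_nonneg f (I.erase i) (f i).1
  have hb := trailCount_nonneg f (I.erase i) (f i).2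
  simp only [Finset.mem_union]
  split_ifs at key ⊢ with h3 h4 h5 <;> first | linarith | (exfalso; tauto)

lemma pairSum_sub_le (f : ι → Clause V) (I : Finset ι) (i : ι) {w : ℝ} {U : Finset (Lit V)}
    (hw : w = trailCount f (I.erase i) (f i).1 + trailCount f (I.erase i) (f i).2)
    (hU : U = trailSet f (I.erase i) (f i).1 ∪ trailSet f (I.erase i) (f i).2) :
    pairSum f I - pairSum f (I.erase i) ≤
      2 * w * ∑ z ∈ U, trailCount f (I.erase i) z + w ^ 2 * U.card := by
  have hw0 : 0 ≤ w := by
    rw [hw]; exact add_nonneg (trailCount_nonneg _ _ _) (trailCount_nonneg _ _ _)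
  set A := trailCount f (I.erase i) with hA
  have hA0 : ∀ y, 0 ≤ A y := trailCount_nonneg _ _
  set d : Lit V → ℝ := fun y => if y ∈ U then w else 0 with hd
  have hd0 : ∀ y, 0 ≤ d y := fun y => ite_nonneg hw0 le_rfl
  have hdw : ∀ y, d y ≤ w := fun y => by simp only [hd]; split_ifs <;> simp [hw0]
  have hle : ∀ y, trailCount f I y ≤ A y + d y.negate := by
    intro y
    have := trailCount_le_of_erase f I i y
    rwa [← hU, ← hA, ← hw] at this
  have hsum : ∀ g : Lit V → ℝ, ∑ l, g l * d l = w * ∑ z ∈ U, g z := by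
    intro g
    simp [hd, Finset.sum_ite_mem, Finset.mul_sum, mul_comm]
  calc pairSum f I - pairSum f (I.erase i)
      ≤ ∑ l : Lit V, (A l + d l.negate) * (A l.negate + d l) - ∑ l : Lit V, A l * A l.negate := by
        refine sub_le_sub_right (Finset.sum_le_sum fun l _ => ?_) _
        have h2 := hle l.negate
        rw [Lit.negate_negate] at h2
        exact mul_le_mul (hle l) h2 (trailCount_nonneg _ _ _) (add_nonneg (hA0 _) (hd0 _))
    _ = ∑ l, A l * d l + ∑ l : Lit V, A l.negate * d l.negate + ∑ l : Lit V, d l.negate * d l := by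
        rw [← Finset.sum_sub_distrib, ← Finset.sum_add_distrib, ← Finset.sum_add_distrib]
        exact Finset.sum_congr rfl fun l _ => by ring
    _ ≤ ∑ l, A l * d l + ∑ l, A l * d l + ∑ l, w * d l := by
        rw [sum_negate fun l => A l * d l]
        gcongr with l
        exact hdw _
    _ = _ := by
        rw [hsum, hsum fun _ => w, Finset.sum_const, nsmul_eq_mul]
        ring

lemma sq_pairSum_sub_le (f : ι → Clause V) (I : Finset ι) (i : ι) :
    (pairSum f I - pairSum f (I.erase i)) ^ 2 ≤ influence f (I.erase i) (f i) := by
  obtain ⟨w, hw⟩ : ∃ w, w = trailCount f (I.erase i) (f i).1 + trailCount f (I.erase i) (f i).2 :=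
    ⟨_, rfl⟩
  obtain ⟨U, hU⟩ : ∃ U, U = trailSet f (I.erase i) (f i).1 ∪ trailSet f (I.erase i) (f i).2 :=
    ⟨_, rfl⟩
  have key := pairSum_sub_le f I i hw hU
  have h0 := sub_nonneg.2 (pairSum_erase_le f I i)
  unfold influence
  set A := trailCount f (I.erase i) with hA
  have hA0 : ∀ y, 0 ≤ A y := trailCount_nonneg _ _
  have hw0 : 0 ≤ w := by rw [hw]; exact add_nonneg (hA0 _) (hA0 _)
  have hUw : (U.card : ℝ) ≤ w := by
    rw [hw, hU, hA]
    unfold trailCount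
    exact_mod_cast Finset.card_union_le _ _
  have hUsum : ∑ z ∈ U, A z ^ 5 ≤ ∑ z ∈ trailSet f (I.erase i) (f i).1, A z ^ 5 +
      ∑ z ∈ trailSet f (I.erase i) (f i).2, A z ^ 5 := by
    rw [hU, ← Finset.sum_union_inter]
    exact le_add_of_nonneg_right (Finset.sum_nonneg fun z _ => pow_nonneg (hA0 z) _)
  have hCS : (∑ z ∈ U, A z) ^ 2 ≤ w * ∑ z ∈ U, A z ^ 2 :=
    sq_sum_le_card_mul_sum_sq.trans (mul_le_mul_of_nonneg_right hUw
      (Finset.sum_nonneg fun z _ => sq_nonneg _))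
  have hw6 : w ^ 6 ≤ 32 * (A (f i).1 ^ 6 + A (f i).2 ^ 6) := by
    rw [hw]
    exact (add_pow_le (hA0 _) (hA0 _) 6).trans_eq (by norm_num)
  have hmix : w ^ 3 * ∑ z ∈ U, A z ^ 2 ≤ w ^ 6 + ∑ z ∈ U, A z ^ 5 := by
    calc w ^ 3 * ∑ z ∈ U, A z ^ 2 ≤ ∑ z ∈ U, (w ^ 5 + A z ^ 5) := by
          rw [Finset.mul_sum]
          refine Finset.sum_le_sum fun z _ => ?_
          have hz := hA0 z
          rcases le_total (A z) w with h | h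
          · calc w ^ 3 * A z ^ 2 ≤ w ^ 3 * w ^ 2 := by gcongr
              _ ≤ w ^ 5 + A z ^ 5 := by rw [← pow_add]; exact le_add_of_nonneg_right (by positivity)
          · calc w ^ 3 * A z ^ 2 ≤ A z ^ 3 * A z ^ 2 := by gcongr
              _ ≤ w ^ 5 + A z ^ 5 := by rw [← pow_add]; exact le_add_of_nonneg_left (by positivity)
      _ = U.card * w ^ 5 + ∑ z ∈ U, A z ^ 5 := by
          rw [Finset.sum_add_distrib, Finset.sum_const, nsmul_eq_mul]
      _ ≤ w * w ^ 5 + ∑ z ∈ U, A z ^ 5 := by gcongr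
      _ = _ := by ring
  set Q := ∑ z ∈ U, A z with hQ
  have h1 : pairSum f I - pairSum f (I.erase i) ≤ 2 * w * Q + w ^ 3 :=
    key.trans (by
      have : w ^ 2 * U.card ≤ w ^ 2 * w := by gcongr
      linarith [pow_succ w 2])
  calc (pairSum f I - pairSum f (I.erase i)) ^ 2 ≤ (2 * w * Q + w ^ 3) ^ 2 := by gcongr
    _ ≤ 8 * w ^ 2 * Q ^ 2 + 2 * w ^ 6 := by nlinarith [sq_nonneg (2 * w * Q - w ^ 3)]
    _ ≤ 8 * w ^ 2 * (w * ∑ z ∈ U, A z ^ 2) + 2 * w ^ 6 := by gcongr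
    _ = 8 * (w ^ 3 * ∑ z ∈ U, A z ^ 2) + 2 * w ^ 6 := by ring
    _ ≤ _ := by linarith

lemma exists_variance_pairSum_le {α : ℝ} (hα0 : 0 ≤ α) (hα : α < 1) :
    ∃ D : ℝ, 0 ≤ D ∧ ∀ n m : ℕ, 2 ≤ n → (m : ℝ) ≤ α * n →
      expF n m (fun f => (pairSum f Finset.univ -
        expF n m (fun f => pairSum f Finset.univ)) ^ 2) ≤ D * n := by
  obtain ⟨M, hM0, hM⟩ := exists_momentBound hα0 hα 5
  obtain ⟨M', hM'0, hM'⟩ := exists_expF_sum_trailCount_le hα0 hα 4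
  refine ⟨640 * M + 16 * M', by positivity, fun n m hn hm => ?_⟩
  set g : FSpace n m → ℝ := fun f => pairSum f Finset.univ with hg
  have hign : ∀ i, IgnoresCoord i (fun f : FSpace n m => pairSum f (Finset.univ.erase i)) := by
    intro i f f' h
    simp only [pairSum, trailCount_erase_congr h]
  have hinf : ∀ i, expF n m (fun f => (g f - pairSum f (Finset.univ.erase i)) ^ 2) ≤
      640 * M + 16 * M' := by
    intro i
    refine (expF_mono fun f _ => sq_pairSum_sub_le f Finset.univ i).trans
      (expF_coord_le hn (F := fun c f => influence f (Finset.univ.erase i) c) ?_ ?_)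
    · intro c f f' h
      simp only [influence, trailCount_erase_congr h, trailSet_erase_congr h]
    · intro c _
      simp only [influence]
      rw [expF_add, expF_mul_left, expF_mul_left, expF_add, expF_add]
      have h1 := hM n m hn hm (Finset.univ.erase i) c.1
      have h2 := hM n m hn hm (Finset.univ.erase i) c.2
      have h3 := hM' n m hn hm (Finset.univ.erase i) c.1
      have h4 := hM' n m hn hm (Finset.univ.erase i) c.2
      linarith
  have hvar : expF n m (fun f => (g f - expF n m g) ^ 2) =
      expF n m (fun f => g f ^ 2) - expF n m g ^ 2 := by
    rw [expF_sub_sq g fun _ => expF n m g, expF_const hn]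
    simp_rw [mul_comm (g _)]
    rw [expF_mul_left]
    ring
  rw [hvar]
  refine (expF_sq_sub_sq_expF_le hn g hign).trans ((Finset.sum_le_sum fun i _ => hinf i).trans ?_)
  rw [Finset.sum_const, nsmul_eq_mul, Finset.card_univ, Fintype.card_fin, mul_comm]
  exact mul_le_mul_of_nonneg_left (hm.trans (mul_le_of_le_one_left (Nat.cast_nonneg _) hα.le))
    (by positivity)

end PairSums

section MainResult

lemma sum_const_lit {n : ℕ} (a : ℝ) : ∑ _l : Lit (Fin n), a = 2 * n * a := by
  simp [mul_assoc]

lemma exists_expF_pairSum_le {α : ℝ} (hα0 : 0 ≤ α) (hα : α < 1) :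
    ∃ C : ℝ, 0 ≤ C ∧ ∀ n m : ℕ, 2 ≤ n → (m : ℝ) ≤ α * n →
      expF n m (fun f => pairSum f Finset.univ) ≤ 2 * n * (1 / (1 - α) ^ 2 + C / √(n - 1)) := by
  obtain ⟨C, hC0, hC⟩ := exists_expF_trailCount_mul_le hα0 hα
  refine ⟨C, hC0, fun n m hn hm => ?_⟩
  unfold pairSum
  rw [expF_sum, ← sum_const_lit]
  exact Finset.sum_le_sum fun l _ => hC n m hn hm _ l _ (Lit.negate_ne l)

/-- If the clause density is at most `α`, the running time exceeds the bound with probability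
of order at most `1 / √n`. -/
lemma exists_le_prF_wsExp_le {α : ℝ} (hα0 : 0 ≤ α) (hα : α < 1) :
    ∃ E : ℝ, ∀ n m : ℕ, 2 ≤ n → (m : ℝ) ≤ α * n → E / √(n - 1) ≤ 1 →
      1 - E / √(n - 1) ≤ prF n m fun f =>
        wsExp (toCNF f) (fun ω => (wsT (toCNF f) ω : ℝ)) ≤ 2 * n * (1 / (1 - α) ^ 2 + 2) := by
  obtain ⟨C₁, hC₁0, hC₁⟩ := exists_expF_pairSum_le hα0 hα
  obtain ⟨C₂, hC₂0, hC₂⟩ := exists_expF_closings_mul_sq_le hα0 hα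
  obtain ⟨K, hK0, hK⟩ := exists_expF_closings_le hα0 hα
  obtain ⟨D, hD0, hD⟩ := exists_variance_pairSum_le hα0 hα
  refine ⟨D + C₁ + 2 * C₂ + 4 * K, fun n m hn hm hE => ?_⟩
  have hn' : (2 : ℝ) ≤ n := by exact_mod_cast hn
  have hn1 : (0 : ℝ) < n - 1 := by linarith
  have hn0 : (0 : ℝ) < n := by linarith
  set s := √((n : ℝ) - 1) with hs
  have hs0 : 0 < s := Real.sqrt_pos.2 hn1
  have hs2 : (n : ℝ) - 1 = s ^ 2 := (Real.sq_sqrt hn1.le).symm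
  have hs1 : 1 ≤ s := Real.one_le_sqrt.2 (by linarith)
  set μ := expF n m (fun f => pairSum f Finset.univ) with hμ
  set B : FSpace n m → ℝ := fun f => ∑ l : Lit (Fin n),
    (if Closings f 1 Finset.univ {l.2} l.negate then 1 else 0) *
      trailCount f Finset.univ l ^ 2 with hB
  set R : FSpace n m → ℝ := fun f => ∑ l : Lit (Fin n),
    if Closings f 2 Finset.univ {l.2} l then 1 else 0 with hR
  set X : FSpace n m → ℝ := fun f => (pairSum f Finset.univ - μ) ^ 2 with hX
  have hX0 : ∀ f, 0 ≤ X f := fun f => sq_nonneg _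
  have hB0 : ∀ f, 0 ≤ B f := fun f => Finset.sum_nonneg fun l _ =>
    mul_nonneg (ite_nonneg zero_le_one le_rfl) (sq_nonneg _)
  have hR0 : ∀ f, 0 ≤ R f := fun f => Finset.sum_nonneg fun l _ => ite_nonneg zero_le_one le_rfl
  have hEX : expF n m X ≤ D * n := hD n m hn hm
  have hEB : expF n m B ≤ 2 * n * (C₂ / s) := by
    rw [hB, expF_sum, ← sum_const_lit]
    exact Finset.sum_le_sum fun l _ => hC₂ n m hn hm _ _ _ _
  have hER : expF n m R ≤ 2 * n * (K / (n - 1) ^ 2) := by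
    rw [hR, expF_sum, ← sum_const_lit]
    exact Finset.sum_le_sum fun l _ => (hK n m hn hm _ _ _).2
  have hC₁s : C₁ / s ≤ 1 := by
    refine le_trans ?_ hE
    gcongr
    linarith
  have hpt : ∀ f : FSpace n m, 1 - ((n ^ 2 : ℝ)⁻¹ * X f + (n : ℝ)⁻¹ * B f + R f) ≤
      if wsExp (toCNF f) (fun ω => (wsT (toCNF f) ω : ℝ)) ≤
        2 * n * (1 / (1 - α) ^ 2 + 2) then 1 else 0 := by
    intro f
    have h1 : 0 ≤ (n ^ 2 : ℝ)⁻¹ * X f := mul_nonneg (by positivity) (hX0 f)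
    have h2 : 0 ≤ (n : ℝ)⁻¹ * B f := mul_nonneg (by positivity) (hB0 f)
    have h3 := hR0 f
    by_cases hgood : wsExp (toCNF f) (fun ω => (wsT (toCNF f) ω : ℝ)) ≤
        2 * n * (1 / (1 - α) ^ 2 + 2)
    · rw [if_pos hgood]; linarith
    rw [if_neg hgood]
    by_contra! hlt
    apply hgood
    have hX1 : (n ^ 2 : ℝ)⁻¹ * X f < 1 := by linarith
    have hB1 : (n : ℝ)⁻¹ * B f < 1 := by linarith
    have hR1 : R f < 1 := by linarith
    rw [inv_mul_lt_iff₀ (by positivity), mul_one] at hX1 hB1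
    have hno : ∀ l, ¬ Closings f 2 Finset.univ {l.2} l := by
      intro l hl
      have := Finset.single_le_sum
        (f := fun l : Lit (Fin n) => if Closings f 2 Finset.univ {l.2} l then (1 : ℝ) else 0)
        (fun l _ => ite_nonneg zero_le_one le_rfl) (Finset.mem_univ l)
      simp only [if_pos hl] at this
      linarith
    have hS : pairSum f Finset.univ - μ < n := lt_of_pow_lt_pow_left₀ 2 hn0.le hX1
    have hmain := wsExp_wsT_le_of_not_closings f hno
    have hBeq : (∑ l : Lit (Fin n), if Closings f 1 Finset.univ {l.2} l.negate then
        ((trailSet f Finset.univ l).card : ℝ) ^ 2 else 0) = B f :=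
      Finset.sum_congr rfl fun l _ => by rw [ite_mul, one_mul, zero_mul]; rfl
    rw [hBeq] at hmain
    have hμle := hC₁ n m hn hm
    have hμ' : μ ≤ 2 * n * (1 / (1 - α) ^ 2 + 1) := hμle.trans (by gcongr)
    refine hmain.trans ?_
    change pairSum f Finset.univ + B f ≤ _
    linarith
  rw [prF_eq_expF]
  refine le_trans ?_ (expF_mono fun f _ => hpt f)
  rw [expF_sub, expF_const hn, expF_add, expF_add, expF_mul_left, expF_mul_left]
  refine sub_le_sub_left ?_ 1
  have hns : s ≤ n := by nlinarith
  calc _ ≤ (n ^ 2 : ℝ)⁻¹ * (D * n) + (n : ℝ)⁻¹ * (2 * n * (C₂ / s)) +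
        2 * n * (K / (n - 1) ^ 2) := by gcongr
    _ ≤ D / s + 2 * C₂ / s + 4 * K / s := by
        gcongr ?_ + ?_ + ?_
        · calc (n ^ 2 : ℝ)⁻¹ * (D * n) = D / n := by field_simp
            _ ≤ D / s := by gcongr
        · exact le_of_eq (by field_simp)
        · calc 2 * (n : ℝ) * (K / (n - 1) ^ 2) ≤ 2 * (2 * (n - 1)) * (K / (n - 1) ^ 2) := by
                gcongr; linarith
            _ = 4 * K / (n - 1) := by field_simp; ring
            _ ≤ 4 * K / s := by
                gcongr
                rw [hs2]
                nlinarith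
    _ ≤ (D + C₁ + 2 * C₂ + 4 * K) / s := by
        rw [← add_div, ← add_div]
        gcongr
        linarith

end MainResult

/-- **Theorem 1.1 (main result).** There exists a constant `C > 0` such that for every
`0 ≤ α < 1` the following holds: if `m = m(n) ∼ αn`, then with high probability over the random
2-CNF `Φ = Φ_{n,m}`, the expected number of flips of WalkSAT on `Φ` (expectation over the random
choices of the algorithm only) satisfies `E[T(Φ) ∣ Φ] ≤ C n / (1 − α)²`. -/
theorem stmt_0 :
    ∃ C : ℝ, 0 < C ∧
      ∀ α : ℝ, 0 ≤ α → α < 1 →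
        ∀ m : ℕ → ℕ, Tendsto (fun n => (m n : ℝ) / (n : ℝ)) atTop (nhds α) →
          Tendsto
            (fun n =>
              prF n (m n) fun f =>
                wsExp (toCNF f) (fun ω => (wsT (toCNF f) ω : ℝ)) ≤
                  C * (n : ℝ) / (1 - α) ^ 2)
            atTop (nhds 1) := by
  refine ⟨12, by norm_num, fun α hα0 hα m hm => ?_⟩
  have hpos : 0 < 1 - α := by linarith
  have hβ0 : 0 ≤ (1 + α) / 2 := by linarith
  have hβ1 : (1 + α) / 2 < 1 := by linarith
  obtain ⟨E, hE⟩ := exists_le_prF_wsExp_le hβ0 hβ1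
  have hlim : Tendsto (fun n : ℕ => E / √((n : ℝ) - 1)) atTop (nhds 0) :=
    (Real.tendsto_sqrt_atTop.comp
      (tendsto_atTop_add_const_right _ (-1) tendsto_natCast_atTop_atTop)).const_div_atTop E
  have hm' : ∀ᶠ n in atTop, (m n : ℝ) / n < (1 + α) / 2 :=
    hm.eventually (gt_mem_nhds (by linarith))
  have hsub : Tendsto (fun n : ℕ => 1 - E / √((n : ℝ) - 1)) atTop (nhds 1) := by
    simpa using hlim.const_sub 1
  refine tendsto_of_tendsto_of_tendsto_of_le_of_le' hsub tendsto_const_nhds ?_ ?_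
  · filter_upwards [hm', hlim.eventually (gt_mem_nhds zero_lt_one), eventually_ge_atTop 2]
      with n h1 h2 h3
    have hn0 : (0 : ℝ) < n := by exact_mod_cast (by omega : 0 < n)
    rw [div_lt_iff₀ hn0] at h1
    refine (hE n (m n) h3 h1.le h2.le).trans ?_
    rw [prF_eq_expF, prF_eq_expF]
    refine expF_mono fun f _ => ?_
    have hbound : 2 * (n : ℝ) * (1 / (1 - (1 + α) / 2) ^ 2 + 2) ≤ 12 * n / (1 - α) ^ 2 := by
      have h4 : 1 / (1 - (1 + α) / 2) ^ 2 = 4 * (1 / (1 - α) ^ 2) := by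
        rw [show 1 - (1 + α) / 2 = (1 - α) / 2 by ring]
        field_simp
        norm_num
      have h5 : 1 ≤ 1 / (1 - α) ^ 2 := by
        rw [le_div_iff₀ (by positivity)]
        nlinarith
      rw [h4, mul_div_assoc, div_eq_mul_one_div (n : ℝ)]
      nlinarith [mul_le_mul_of_nonneg_left h5 hn0.le]
    split_ifs with h4 h5
    · exact le_rfl
    · exact absurd (h4.trans hbound) h5
    · exact zero_le_one
    · exact le_rfl
  · exact Eventually.of_forall fun n => div_le_one_of_le₀
      (Nat.cast_le.2 (Finset.card_filter_le _ _)) (Nat.cast_nonneg _)
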